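/- arXiv:2507.18779 — 3 statements merged into one kernel-verified Lean document; each statement's English description precedes it below -/
import Mathlib

section
/- For every integer d ≥ 2 and every real number β > 12, the d-ary β-free shift X^d_β has a unique measure of maximal entropy: there exists exactly one invariant Borel probability measure μ on X^d_β with h_μ = h. -/
open MeasureTheory Filter Real Set

/-- The left shift on bi-infinite sequences. -/
def shift {A : Type*} (x : ℤ → A) : ℤ → A := fun n => x (n + 1)

/-- `w` occurs as a factor (finite subword) of the bi-infinite sequence `x`. -/
def FactorOf {A : Type*} (w : List A) (x : ℤ → A) : Prop :=
  ∃ i : ℤ, ∀ t : ℕ, (ht : t < w.length) → x (i + t) = w[t]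

/-- `ℓ` is a period of the word `w`. -/
def HasPeriodN {A : Type*} (w : List A) (ℓ : ℕ) : Prop :=
  1 ≤ ℓ ∧ ℓ ≤ w.length ∧ ∀ t : ℕ, (ht : t + ℓ < w.length) →
    w[t]'(lt_of_le_of_lt (Nat.le_add_right t ℓ) ht) = w[t + ℓ]

/-- The `d`-ary `β`-free shift. -/
def betaFree (d : ℕ) (β : ℝ) : Set (ℤ → Fin d) :=
  {x | ∀ w : List (Fin d), FactorOf w x → ∀ ℓ : ℕ, HasPeriodN w ℓ → (w.length : ℝ) < β * ℓ}

/-- The language of a shift space. -/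
def language {A : Type*} (X : Set (ℤ → A)) : Set (List A) :=
  {w | ∃ x ∈ X, FactorOf w x}

/-- The words of length `n` in the language of `X`. -/
def langN {A : Type*} (X : Set (ℤ → A)) (n : ℕ) : Set (List A) :=
  {w | w ∈ language X ∧ w.length = n}

/-- The cylinder of a word. -/
def cylinder {A : Type*} (w : List A) : Set (ℤ → A) :=
  {x | ∀ t : ℕ, (ht : t < w.length) → x (t : ℤ) = w[t]}

/-- A shift space: closed and shift-invariant. -/
def IsShiftSpace {A : Type*} [TopologicalSpace A] (X : Set (ℤ → A)) : Prop :=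
  IsClosed X ∧ shift '' X = X

/-- Invariance of a measure under the shift. -/
def IsShiftInvariant {A : Type*} [MeasurableSpace A] (μ : Measure (ℤ → A)) : Prop :=
  ∀ E : Set (ℤ → A), MeasurableSet E → μ (shift ⁻¹' E) = μ E

/-- The `n`-th partition sum `H_n(μ) = Σ_w −μ[w] log μ[w]`. -/
noncomputable def cylEntropySum {A : Type*} [Fintype A] [MeasurableSpace A]
    (μ : Measure (ℤ → A)) (n : ℕ) : ℝ :=
  ∑ w : Fin n → A, Real.negMulLog (μ (cylinder (List.ofFn w))).toReal

/-- `μ` is a measure of maximal entropy on `X` (with topological entropy `h`). -/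
def IsMME {A : Type*} [Fintype A] [MeasurableSpace A]
    (X : Set (ℤ → A)) (h : ℝ) (μ : Measure (ℤ → A)) : Prop :=
  IsProbabilityMeasure μ ∧ μ X = 1 ∧ IsShiftInvariant μ ∧
    Tendsto (fun n : ℕ => cylEntropySum μ n / n) atTop (nhds h)

/-- A word is a 4-power. -/
def IsFourPower {A : Type*} (s : List A) : Prop :=
  ∃ v : List A, v ≠ [] ∧ s = v ++ v ++ v ++ v

/-- Good words: words of the language no prefix or suffix of which is a 4-power. -/
def goodWords {A : Type*} (X : Set (ℤ → A)) : Set (List A) :=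
  {w | w ∈ language X ∧ (∀ p : List A, p <+: w → ¬ IsFourPower p) ∧
       (∀ s : List A, s <:+ w → ¬ IsFourPower s)}

/-- Words of the language that are concatenations of 4-powers of words of the language. -/
def fourPowerConcat {A : Type*} (X : Set (ℤ → A)) : Set (List A) :=
  {w | w ∈ language X ∧ ∃ ps : List (List A),
      (∀ p ∈ ps, ∃ v ∈ language X, v ≠ [] ∧ p = v ++ v ++ v ++ v) ∧ w = ps.flatten}

/-- Alternating concatenation `w₁u₁w₂u₂⋯`. -/
def alternate {A : Type*} : List (List A) → List (List A) → List A
  | [], _ => []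
  | w :: _, [] => w
  | w :: ws, u :: us => w ++ u ++ alternate ws us

/-- The map deleting the first `i` and the last `k` symbols of a word. -/
def phi {A : Type*} (i k : ℕ) (w : List A) : List A := (w.drop i).take (w.length - i - k)

/-- Maximal `k` such that the first `k` symbols of `w` follow the periodic
pattern of period `ℓ` determined by the prefix of `w` of length `ℓ`. -/
noncomputable def preK {A : Type*} (w : List A) (ℓ : ℕ) : ℕ :=
  sSup {k | k ≤ w.length ∧ ∀ t < k, w[t]? = w[t % ℓ]?}

/-- `pre_ℓ(w)`: the number of times the length-`ℓ` prefix of `w` repeats at the start of `w`. -/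
noncomputable def pre {A : Type*} (w : List A) (ℓ : ℕ) : ℝ := (preK w ℓ : ℝ) / ℓ

/-- `suf_ℓ(w)`: the number of times the length-`ℓ` suffix of `w` repeats at the end of `w`. -/
noncomputable def suf {A : Type*} (w : List A) (ℓ : ℕ) : ℝ := pre w.reverse ℓ

lemma hasPeriodN_iff_getElem? {A : Type*} {w : List A} {ℓ : ℕ} :
    HasPeriodN w ℓ ↔
      1 ≤ ℓ ∧ ℓ ≤ w.length ∧ ∀ t, t + ℓ < w.length → w[t]? = w[t + ℓ]? := by
  unfold HasPeriodN
  refine and_congr_right fun _ => and_congr_right fun _ => forall_congr' fun t =>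
    forall_congr' fun ht => ?_
  rw [List.getElem?_eq_getElem ht, List.getElem?_eq_getElem (by omega), Option.some_inj]

lemma HasPeriodN.reverse {A : Type*} {w : List A} {ℓ : ℕ} (hw : HasPeriodN w ℓ) :
    HasPeriodN w.reverse ℓ := by
  obtain ⟨h1, h2, h3⟩ := hasPeriodN_iff_getElem?.1 hw
  refine hasPeriodN_iff_getElem?.2 ⟨h1, by simpa using h2, fun t ht => ?_⟩
  rw [List.length_reverse] at ht
  rw [List.getElem?_reverse (by omega), List.getElem?_reverse ht,
    show w.length - 1 - t = w.length - 1 - (t + ℓ) + ℓ by omega]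
  exact (h3 _ (by omega)).symm

/-- A word is `β`-free if none of its factors has a period `ℓ` and length at least `β * ℓ`. -/
def IsFree {A : Type*} (β : ℝ) (w : List A) : Prop :=
  ∀ u, u <:+: w → ∀ ℓ, HasPeriodN u ℓ → (u.length : ℝ) < β * ℓ

lemma IsFree.of_isInfix {A : Type*} {β : ℝ} {u w : List A} (hw : IsFree β w) (h : u <:+: w) :
    IsFree β u :=
  fun v hv => hw v (hv.trans h)

lemma IsFree.take {A : Type*} {β : ℝ} {w : List A} (hw : IsFree β w) (n : ℕ) :
    IsFree β (w.take n) :=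
  hw.of_isInfix (List.take_prefix n w).isInfix

lemma IsFree.reverse {A : Type*} {β : ℝ} {w : List A} (hw : IsFree β w) :
    IsFree β w.reverse := by
  intro u hu ℓ hℓ
  have := hw u.reverse (by rw [← List.reverse_infix, List.reverse_reverse]; exact hu) ℓ hℓ.reverse
  simpa using this

lemma isFree_nil {A : Type*} (β : ℝ) : IsFree β ([] : List A) := by
  intro u hu ℓ ⟨h1, h2, _⟩
  have := hu.length_le
  simp only [List.length_nil] at this
  omega

/-- The last `L` letters of `w` continue a repetition of period `ℓ`. -/
def SuffixRepeats {A : Type*} (w : List A) (L ℓ : ℕ) : Prop :=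
  1 ≤ ℓ ∧ L + ℓ ≤ w.length ∧
    ∀ t, w.length - L ≤ t → t < w.length → w[t]? = w[t - ℓ]?

/-- A word determined by a prefix and a repetition covering the remaining letters. -/
lemma SuffixRepeats.eq_of_take_eq {A : Type*} {w w' : List A} {L ℓ : ℕ}
    (hw : SuffixRepeats w L ℓ) (hw' : SuffixRepeats w' L ℓ) (hlen : w.length = w'.length)
    (h : w.take (w.length - L) = w'.take (w.length - L)) : w = w' := by
  obtain ⟨h1, h2, h3⟩ := hw
  obtain ⟨-, h2', h3'⟩ := hw'
  have key : ∀ t : ℕ, w[t]? = w'[t]? := by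
    intro t
    induction t using Nat.strong_induction_on with
    | _ t ih =>
      by_cases ht : t < w.length
      · by_cases htL : t < w.length - L
        · have : (w.take (w.length - L))[t]? = (w'.take (w.length - L))[t]? := by rw [h]
          rwa [List.getElem?_take_of_lt htL, List.getElem?_take_of_lt htL] at this
        · rw [h3 t (by omega) ht, h3' t (by omega) (by omega)]
          exact ih _ (by omega)
      · rw [List.getElem?_eq_none (by omega), List.getElem?_eq_none (by omega)]
  exact List.ext_getElem? key

lemma HasPeriodN.suffixRepeats {A : Type*} {s u : List A} {L ℓ : ℕ} (hs : HasPeriodN s ℓ)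
    (hsu : s <:+ u) (hL : L + ℓ ≤ s.length) : SuffixRepeats u L ℓ := by
  obtain ⟨h1, h2, h3⟩ := hasPeriodN_iff_getElem?.1 hs
  obtain ⟨p, rfl⟩ := hsu
  refine ⟨h1, by simp; omega, fun t ht ht' => ?_⟩
  rw [List.length_append] at ht ht'
  rw [List.getElem?_append_right (by omega), List.getElem?_append_right (by omega),
    h3 (t - ℓ - p.length) (by omega)]
  congr 1
  omega

lemma HasPeriodN.of_isInfix {A : Type*} {s u : List A} {ℓ : ℕ} (hs : HasPeriodN s ℓ)
    (hu : u <:+: s) (hℓ : ℓ ≤ u.length) : HasPeriodN u ℓ := by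
  obtain ⟨h1, h2, h3⟩ := hasPeriodN_iff_getElem?.1 hs
  obtain ⟨p, q, rfl⟩ := hu
  refine hasPeriodN_iff_getElem?.2 ⟨h1, hℓ, fun t ht => ?_⟩
  have key : ∀ t < u.length, (p ++ u ++ q)[p.length + t]? = u[t]? := fun t ht => by
    rw [List.append_assoc, List.getElem?_append_right (by omega), Nat.add_sub_cancel_left,
      List.getElem?_append_left ht]
  rw [← key t (by omega), ← key _ ht, ← Nat.add_assoc]
  exact h3 (p.length + t) (by simp; omega)

lemma SuffixRepeats.of_suffix {A : Type*} {s u : List A} {L ℓ : ℕ} (hs : SuffixRepeats s L ℓ)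
    (hsu : s <:+ u) : SuffixRepeats u L ℓ := by
  obtain ⟨h1, h2, h3⟩ := hs
  obtain ⟨p, rfl⟩ := hsu
  refine ⟨h1, by simp; omega, fun t ht ht' => ?_⟩
  rw [List.length_append] at ht ht'
  rw [List.getElem?_append_right (by omega), List.getElem?_append_right (by omega),
    h3 (t - p.length) (by omega) (by omega)]
  congr 1
  omega

/-- No suffix of `w` is a fourth power. -/
def NoFourthPowerSuffix {A : Type*} (w : List A) : Prop :=
  ∀ ℓ, ¬ SuffixRepeats w (3 * ℓ) ℓ

lemma NoFourthPowerSuffix.suffix {A : Type*} {s u : List A} (hu : NoFourthPowerSuffix u)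
    (hsu : s <:+ u) : NoFourthPowerSuffix s :=
  fun ℓ hs => hu ℓ (hs.of_suffix hsu)

lemma infix_append_cases {A : Type*} {s u v : List A} (h : s <:+: u ++ v) :
    s <:+: u ∨ s <:+: v ∨ ∃ s₁ s₂, s = s₁ ++ s₂ ∧ s₁ <:+ u ∧ s₂ <+: v := by
  obtain ⟨p, q, h⟩ := h
  rw [List.append_eq_append_iff] at h
  rcases h with ⟨a, rfl, h⟩ | ⟨c, h, rfl⟩
  · exact Or.inl ⟨p, a, rfl⟩
  · rw [List.append_eq_append_iff] at h
    rcases h with ⟨a, rfl, rfl⟩ | ⟨b, rfl, rfl⟩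
    · exact Or.inr (Or.inr ⟨a, c, rfl, List.suffix_append _ _, List.prefix_append _ _⟩)
    · exact Or.inr (Or.inl ⟨b, q, rfl⟩)

/-- Concatenating free words without fourth powers at the junction yields a free word. -/
lemma IsFree.append {A : Type*} {β : ℝ} (hβ : 12 < β) {u v : List A} (hu : IsFree β u)
    (hv : IsFree β v) (hus : NoFourthPowerSuffix u) (hvs : NoFourthPowerSuffix v.reverse) :
    IsFree β (u ++ v) := by
  intro s hs ℓ hℓ
  rcases infix_append_cases hs with h | h | ⟨s₁, s₂, rfl, h₁, h₂⟩
  · exact hu s h ℓ hℓ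
  · exact hv s h ℓ hℓ
  · by_contra! hlong
    have hℓ1 : 1 ≤ ℓ := hℓ.1
    have h12 : 12 * ℓ ≤ (s₁ ++ s₂).length := by
      have : (12 * ℓ : ℝ) ≤ ((s₁ ++ s₂).length : ℝ) :=
        le_trans (by gcongr) hlong
      exact_mod_cast this
    rw [List.length_append] at h12
    by_cases h4 : 4 * ℓ ≤ s₁.length
    · exact hus ℓ ((hℓ.of_isInfix (List.prefix_append s₁ s₂).isInfix (by omega)).suffixRepeats h₁
        (by omega))
    · exact hvs ℓ
        ((hℓ.of_isInfix (List.suffix_append s₁ s₂).isInfix (by omega)).reverse.suffixRepeats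
        (List.reverse_suffix.2 h₂) (by rw [List.length_reverse]; omega))

/-- Words ending in a repetition are counted by what is left after removing it. -/
lemma card_le_sum_of_suffixRepeats {A : Type*} (k n : ℕ) (S : Finset (List A))
    (T : ℕ → Finset (List A))
    (hS : ∀ w ∈ S, w.length = n ∧ ∃ ℓ, SuffixRepeats w (k * ℓ) ℓ ∧ w.take (n - k * ℓ) ∈ T ℓ) :
    S.card ≤ ∑ ℓ ∈ Finset.Icc 1 n, (T ℓ).card := by
  classical
  have hsub : S ⊆ (Finset.Icc 1 n).biUnion fun ℓ =>
      S.filter fun w => SuffixRepeats w (k * ℓ) ℓ ∧ w.take (n - k * ℓ) ∈ T ℓ := by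
    intro w hw
    obtain ⟨hn, ℓ, hℓ, hT⟩ := hS w hw
    simp only [Finset.mem_biUnion, Finset.mem_Icc, Finset.mem_filter]
    exact ⟨ℓ, ⟨hℓ.1, by have := hℓ.2.1; omega⟩, hw, hℓ, hT⟩
  refine (Finset.card_le_card hsub).trans (Finset.card_biUnion_le.trans ?_)
  refine Finset.sum_le_sum fun ℓ _ => ?_
  refine Finset.card_le_card_of_injOn (fun w => w.take (n - k * ℓ)) ?_ ?_
  · intro w hw
    simp only [Finset.coe_filter, mem_ofPred_eq] at hw
    exact hw.2.2
  · intro w hw w' hw' h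
    simp only [Finset.coe_filter, mem_ofPred_eq] at hw hw'
    have hl := (hS w hw.1).1
    have hl' := (hS w' hw'.1).1
    refine hw.2.1.eq_of_take_eq hw'.2.1 (hl.trans hl'.symm) ?_
    rw [hl]
    exact h

lemma sum_Icc_pow_le {r C : ℝ} (hr0 : 0 ≤ r) (hC : r ≤ C * (1 - r)) (hC0 : 0 ≤ C) (n : ℕ) :
    ∑ ℓ ∈ Finset.Icc 1 n, r ^ ℓ ≤ C := by
  have key : ∀ n : ℕ, ∑ ℓ ∈ Finset.Icc 1 n, r ^ ℓ ≤ C * (1 - r ^ n) := by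
    intro n
    induction n with
    | zero => simp
    | succ n ih =>
      rw [Finset.sum_Icc_succ_top (by omega)]
      have : r ^ n * r ≤ r ^ n * (C * (1 - r)) := by gcongr
      rw [pow_succ]
      nlinarith
  refine (key n).trans ?_
  have := pow_nonneg hr0 n
  nlinarith

/-- A concatenation map on sets of words of fixed lengths is injective. -/
lemma card_image_append {A : Type*} [DecidableEq (List A)] {m : ℕ} {S T : Finset (List A)}
    (hS : ∀ w ∈ S, w.length = m) :
    ((S ×ˢ T).image fun p => p.1 ++ p.2).card = S.card * T.card := by
  rw [Finset.card_image_of_injOn, Finset.card_product]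
  rintro ⟨u, v⟩ h ⟨u', v'⟩ h' huv
  simp only [Finset.coe_product, mem_prod, Finset.mem_coe] at h h'
  simpa using List.append_inj huv ((hS _ h.1).trans (hS _ h'.1).symm)

section Counting

variable {A : Type*} [Fintype A]

/-- The words of length `n`. -/
noncomputable def words (A : Type*) [Fintype A] (n : ℕ) : Finset (List A) :=
  (List.finite_length_eq A n).toFinset

@[simp]
lemma mem_words {n : ℕ} {w : List A} : w ∈ words A n ↔ w.length = n := by
  simp [words]

open Classical in
/-- The `β`-free words of length `n`. -/
noncomputable def freeWords (A : Type*) [Fintype A] (β : ℝ) (n : ℕ) : Finset (List A) :=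
  (words A n).filter (IsFree β)

@[simp]
lemma mem_freeWords {β : ℝ} {n : ℕ} {w : List A} :
    w ∈ freeWords A β n ↔ w.length = n ∧ IsFree β w := by
  simp [freeWords]

lemma card_freeWords_zero (β : ℝ) : (freeWords A β 0).card = 1 := by
  rw [Finset.card_eq_one]
  refine ⟨[], ?_⟩
  ext w
  simp only [mem_freeWords, List.length_eq_zero_iff, Finset.mem_singleton]
  exact ⟨fun h => h.1, fun h => ⟨h, h ▸ isFree_nil β⟩⟩

lemma card_freeWords_le_pow_mul {β : ℝ} {m : ℕ}
    (h : ∀ n < m, ((freeWords A β n).card : ℝ) ≤ 2 / 3 * (freeWords A β (n + 1)).card)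
    {j : ℕ} (hj : j ≤ m) :
    ((freeWords A β (m - j)).card : ℝ) ≤ (2 / 3) ^ j * (freeWords A β m).card := by
  induction j with
  | zero => simp
  | succ j ih =>
    have h1 := h (m - (j + 1)) (by omega)
    rw [show m - (j + 1) + 1 = m - j by omega] at h1
    have h2 := ih (by omega)
    rw [pow_succ]
    linarith

/-- Free words grow at least by a factor `3 / 2`. -/
lemma card_freeWords_succ {β : ℝ} (hβ : 12 < β) (hA : 2 ≤ Fintype.card A) (n : ℕ) :
    ((freeWords A β n).card : ℝ) ≤ 2 / 3 * (freeWords A β (n + 1)).card := by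
  classical
  induction n using Nat.strong_induction_on with
  | _ n ih =>
    set ext : Finset (List A) :=
      (freeWords A β n ×ˢ (Finset.univ : Finset A)).image fun p => p.1 ++ [p.2] with hext
    have hcard : ext.card = (freeWords A β n).card * Fintype.card A := by
      rw [hext, Finset.card_image_of_injective, Finset.card_product, Finset.card_univ]
      rintro ⟨u, a⟩ ⟨v, b⟩ h
      simpa using List.append_inj' h rfl
    have hsplit : ext.card ≤ (freeWords A β (n + 1)).card +
        (ext.filter fun w => ¬ IsFree β w).card := by
      rw [← Finset.card_filter_add_card_filter_not (s := ext) (p := fun w => IsFree β w)]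
      gcongr
      intro w hw
      simp only [hext, Finset.mem_filter, Finset.mem_image, Finset.mem_product, mem_freeWords] at hw
      obtain ⟨⟨p, hp, rfl⟩, hw⟩ := hw
      simp [hp.1.1, hw]
    have hbad : (ext.filter fun w => ¬ IsFree β w).card ≤
        ∑ ℓ ∈ Finset.Icc 1 (n + 1),
          (if 12 * ℓ ≤ n + 1 then freeWords A β (n + 1 - 11 * ℓ) else ∅).card := by
      refine card_le_sum_of_suffixRepeats 11 (n + 1) _ _ ?_
      intro w hw
      simp only [hext, Finset.mem_filter, Finset.mem_image, Finset.mem_product, mem_freeWords] at hw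
      obtain ⟨⟨⟨u, a⟩, ⟨⟨hun, hu⟩, -⟩, rfl⟩, hw⟩ := hw
      dsimp only at hun hu hw ⊢
      have hlen : (u ++ [a]).length = n + 1 := by simp [hun]
      refine ⟨hlen, ?_⟩
      simp only [IsFree, not_forall, not_lt] at hw
      obtain ⟨s, hs, ℓ, hℓ, hlong⟩ := hw
      have h12 : 12 * ℓ ≤ s.length := by
        have : (12 * ℓ : ℝ) ≤ (s.length : ℝ) := le_trans (by gcongr) hlong
        exact_mod_cast this
      have hsuf : s <:+ u ++ [a] := by
        rcases List.infix_concat_iff.1 hs with h | h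
        · exact h
        · exact absurd (hu s h ℓ hℓ) (not_lt.2 hlong)
      have hle := hs.length_le
      have hℓ1 := hℓ.1
      refine ⟨ℓ, hℓ.suffixRepeats hsuf (by omega), ?_⟩
      rw [if_pos (by omega), mem_freeWords]
      refine ⟨by rw [List.length_take]; omega, ?_⟩
      rw [List.take_append_of_le_length (by omega)]
      exact hu.take _
    have hsum : (∑ ℓ ∈ Finset.Icc 1 (n + 1),
        ((if 12 * ℓ ≤ n + 1 then freeWords A β (n + 1 - 11 * ℓ) else ∅).card : ℝ)) ≤
        1 / 2 * (freeWords A β n).card := by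
      calc _ ≤ ∑ ℓ ∈ Finset.Icc 1 (n + 1), (1 / 3 : ℝ) ^ ℓ * (freeWords A β n).card := by
            refine Finset.sum_le_sum fun ℓ hℓ => ?_
            rw [Finset.mem_Icc] at hℓ
            split_ifs with h
            · have := card_freeWords_le_pow_mul (A := A) (m := n) ih (j := 11 * ℓ - 1) (by omega)
              rw [show n - (11 * ℓ - 1) = n + 1 - 11 * ℓ by omega] at this
              refine this.trans ?_
              gcongr
              calc (2 / 3 : ℝ) ^ (11 * ℓ - 1) ≤ (2 / 3 : ℝ) ^ (10 * ℓ) :=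
                    pow_le_pow_of_le_one (by norm_num) (by norm_num) (by omega)
                _ = ((2 / 3 : ℝ) ^ 10) ^ ℓ := pow_mul _ _ _
                _ ≤ (1 / 3) ^ ℓ := by gcongr; norm_num
            · rw [Finset.card_empty, Nat.cast_zero]
              positivity
        _ = (∑ ℓ ∈ Finset.Icc 1 (n + 1), (1 / 3 : ℝ) ^ ℓ) * (freeWords A β n).card := by
            rw [Finset.sum_mul]
        _ ≤ _ := by
            gcongr
            exact sum_Icc_pow_le (by norm_num) (by norm_num) (by norm_num) _
    have h1 : ((freeWords A β n).card : ℝ) * 2 ≤ (freeWords A β (n + 1)).card +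
        1 / 2 * (freeWords A β n).card := by
      have hb : ((ext.filter fun w => ¬ IsFree β w).card : ℝ) ≤ 1 / 2 * (freeWords A β n).card :=
        le_trans (by exact_mod_cast hbad) hsum
      have hs : (ext.card : ℝ) ≤ (freeWords A β (n + 1)).card +
        (ext.filter fun w => ¬ IsFree β w).card := by exact_mod_cast hsplit
      have hc : (ext.card : ℝ) = (freeWords A β n).card * Fintype.card A := by
        exact_mod_cast hcard
      have h2 : (2 : ℝ) ≤ Fintype.card A := by exact_mod_cast hA
      have : ((freeWords A β n).card : ℝ) * 2 ≤ (freeWords A β n).card * Fintype.card A := by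
        gcongr
      linarith
    linarith

lemma card_freeWords_sub_le {β : ℝ} (hβ : 12 < β) (hA : 2 ≤ Fintype.card A) {m j : ℕ}
    (hj : j ≤ m) :
    ((freeWords A β (m - j)).card : ℝ) ≤ (2 / 3) ^ j * (freeWords A β m).card :=
  card_freeWords_le_pow_mul (fun n _ => card_freeWords_succ hβ hA n) hj

lemma card_freeWords_pos {β : ℝ} (hβ : 12 < β) (hA : 2 ≤ Fintype.card A) (n : ℕ) :
    0 < (freeWords A β n).card := by
  have h := card_freeWords_sub_le (A := A) hβ hA (le_refl n)
  rw [Nat.sub_self, card_freeWords_zero] at h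
  by_contra! h0
  have : (freeWords A β n).card = 0 := by omega
  rw [this] at h
  norm_num at h

open Classical in
/-- Free words all of whose long prefixes end in a fourth power. -/
noncomputable def unstableWords (A : Type*) [Fintype A] (β : ℝ) (n J : ℕ) : Finset (List A) :=
  (freeWords A β n).filter fun w => ∀ a < J, ¬ NoFourthPowerSuffix (w.take (n - a))

lemma card_unstableWords_le {β : ℝ} (hβ : 12 < β) (hA : 2 ≤ Fintype.card A) (n J : ℕ) :
    ((unstableWords A β n J).card : ℝ) ≤ (6 / 7) ^ J * (freeWords A β n).card := by
  classical
  induction n using Nat.strong_induction_on generalizing J with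
  | _ n ih =>
    rcases Nat.eq_zero_or_pos J with rfl | hJ
    · simp only [pow_zero, one_mul, Nat.cast_le]
      exact Finset.card_filter_le _ _
    have hb : (unstableWords A β n J).card ≤ ∑ ℓ ∈ Finset.Icc 1 n,
        (if 4 * ℓ ≤ n then unstableWords A β (n - 3 * ℓ) (J - 3 * ℓ) else ∅).card := by
      refine card_le_sum_of_suffixRepeats 3 n _ _ ?_
      intro w hw
      simp only [unstableWords, Finset.mem_filter, mem_freeWords] at hw
      obtain ⟨⟨hn, hfree⟩, hw⟩ := hw
      refine ⟨hn, ?_⟩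
      have h0 := hw 0 hJ
      rw [Nat.sub_zero, ← hn, List.take_length] at h0
      simp only [NoFourthPowerSuffix, not_forall, not_not] at h0
      obtain ⟨ℓ, hℓ⟩ := h0
      have h4 := hℓ.2.1
      refine ⟨ℓ, hℓ, ?_⟩
      rw [if_pos (by omega)]
      simp only [unstableWords, Finset.mem_filter, mem_freeWords]
      refine ⟨⟨by rw [List.length_take]; omega, hfree.take _⟩, fun a ha => ?_⟩
      rw [List.take_take, min_eq_left (by omega), Nat.sub_sub]
      exact hw _ (by omega)
    calc ((unstableWords A β n J).card : ℝ)
        ≤ ∑ ℓ ∈ Finset.Icc 1 n,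
          ((if 4 * ℓ ≤ n then unstableWords A β (n - 3 * ℓ) (J - 3 * ℓ) else ∅).card : ℝ) := by
          exact_mod_cast hb
      _ ≤ ∑ ℓ ∈ Finset.Icc 1 n, (1 / 2 : ℝ) ^ ℓ * ((6 / 7) ^ J * (freeWords A β n).card) := by
          refine Finset.sum_le_sum fun ℓ hℓ => ?_
          rw [Finset.mem_Icc] at hℓ
          split_ifs with h
          · calc ((unstableWords A β (n - 3 * ℓ) (J - 3 * ℓ)).card : ℝ)
                ≤ (6 / 7) ^ (J - 3 * ℓ) * (freeWords A β (n - 3 * ℓ)).card :=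
                  ih _ (by omega) _
              _ ≤ (6 / 7) ^ (J - 3 * ℓ) * ((2 / 3) ^ (3 * ℓ) * (freeWords A β n).card) := by
                  gcongr
                  exact card_freeWords_sub_le hβ hA (by omega)
              _ ≤ (6 / 7) ^ (J - 3 * ℓ) *
                    ((6 / 7) ^ (3 * ℓ) * (1 / 2) ^ ℓ * (freeWords A β n).card) := by
                  gcongr
                  rw [pow_mul, pow_mul, ← mul_pow]
                  gcongr
                  norm_num
              _ = (6 / 7) ^ (J - 3 * ℓ + 3 * ℓ) * ((1 / 2) ^ ℓ * (freeWords A β n).card) := by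
                  rw [pow_add]; ring
              _ ≤ (6 / 7) ^ J * ((1 / 2) ^ ℓ * (freeWords A β n).card) := by
                  gcongr ?_ * _
                  exact pow_le_pow_of_le_one (by norm_num) (by norm_num) (by omega)
              _ = _ := by ring
          · rw [Finset.card_empty, Nat.cast_zero]
            positivity
      _ = (∑ ℓ ∈ Finset.Icc 1 n, (1 / 2 : ℝ) ^ ℓ) * ((6 / 7) ^ J * (freeWords A β n).card) := by
          rw [Finset.sum_mul]
      _ ≤ 1 * ((6 / 7) ^ J * (freeWords A β n).card) := by
          gcongr
          exact sum_Icc_pow_le (by norm_num) (by norm_num) (by norm_num) _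
      _ = _ := one_mul _

open Classical in
/-- Free words without fourth powers as suffixes. -/
noncomputable def stableWords (A : Type*) [Fintype A] (β : ℝ) (n : ℕ) : Finset (List A) :=
  (freeWords A β n).filter NoFourthPowerSuffix

lemma card_freeWords_le_stableWords {β : ℝ} (hβ : 12 < β) (hA : 2 ≤ Fintype.card A) (n : ℕ) :
    ((freeWords A β n).card : ℝ) ≤ 7 * (stableWords A β n).card := by
  classical
  have h1 := card_unstableWords_le (A := A) hβ hA n 1
  have h2 : (stableWords A β n).card + (unstableWords A β n 1).card = (freeWords A β n).card := by
    have : unstableWords A β n 1 =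
        (freeWords A β n).filter fun w => ¬ NoFourthPowerSuffix w := by
      refine Finset.filter_congr fun w hw => ?_
      rw [mem_freeWords] at hw
      simp [← hw.1]
    rw [this]
    exact Finset.card_filter_add_card_filter_not _
  have h3 : ((stableWords A β n).card : ℝ) + (unstableWords A β n 1).card =
      (freeWords A β n).card := by exact_mod_cast h2
  linarith

lemma card_freeWords_add_le (β : ℝ) (m n : ℕ) :
    (freeWords A β (m + n)).card ≤ (freeWords A β m).card * (freeWords A β n).card := by
  classical
  rw [← Finset.card_product]
  refine Finset.card_le_card_of_injOn (fun w => (w.take m, w.drop m)) ?_ ?_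
  · intro w hw
    simp only [Finset.mem_coe, mem_freeWords] at hw
    simp only [Finset.coe_product, mem_prod, Finset.mem_coe, mem_freeWords]
    refine ⟨⟨by rw [List.length_take]; omega, hw.2.take m⟩, by rw [List.length_drop]; omega,
      hw.2.of_isInfix (List.drop_suffix m w).isInfix⟩
  · intro w _ w' _ h
    rw [Prod.mk.injEq] at h
    rw [← List.take_append_drop m w, h.1, h.2, List.take_append_drop]

lemma card_mul_card_freeWords_le {β : ℝ} (hβ : 12 < β) (hA : 2 ≤ Fintype.card A) (m n : ℕ) :
    ((freeWords A β m).card : ℝ) * (freeWords A β n).card ≤ 49 * (freeWords A β (m + n)).card := by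
  classical
  have h : (stableWords A β m).card * ((stableWords A β n).image List.reverse).card ≤
      (freeWords A β (m + n)).card := by
    rw [← card_image_append (m := m) (fun w hw => by
      simp only [stableWords, Finset.mem_filter, mem_freeWords] at hw; exact hw.1.1)]
    refine Finset.card_le_card fun w hw => ?_
    simp only [stableWords, Finset.mem_image, Finset.mem_product, Finset.mem_filter,
      mem_freeWords] at hw
    obtain ⟨⟨u, -⟩, ⟨⟨⟨hul, hu⟩, hus⟩, v, ⟨⟨hvl, hv⟩, hvs⟩, rfl⟩, rfl⟩ := hw
    rw [mem_freeWords]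
    exact ⟨by simp [hul, hvl], hu.append hβ hv.reverse hus (by simpa using hvs)⟩
  rw [Finset.card_image_of_injective _ List.reverse_injective] at h
  have h' : ((stableWords A β m).card : ℝ) * (stableWords A β n).card ≤
      (freeWords A β (m + n)).card := by exact_mod_cast h
  have := mul_le_mul (card_freeWords_le_stableWords (A := A) hβ hA m)
    (card_freeWords_le_stableWords (A := A) hβ hA n) (by positivity) (by positivity)
  linarith

end Counting

/-- The word of length `n` seen in `x` from position `i` on. -/
def window {A : Type*} (x : ℤ → A) (i : ℤ) (n : ℕ) : List A :=
  List.ofFn fun t : Fin n => x (i + (t : ℕ))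

section Window

variable {A : Type*}

@[simp]
lemma length_window (x : ℤ → A) (i : ℤ) (n : ℕ) : (window x i n).length = n := by
  simp [window]

lemma getElem_window (x : ℤ → A) (i : ℤ) (n t : ℕ) (ht : t < (window x i n).length) :
    (window x i n)[t] = x (i + t) := by
  simp [window]

lemma window_eq_iff {x : ℤ → A} {i : ℤ} {n : ℕ} {w : List A} (hw : w.length = n) :
    window x i n = w ↔ ∀ t : ℕ, (ht : t < w.length) → x (i + t) = w[t] := by
  constructor
  · rintro rfl t ht
    rw [getElem_window]
  · intro h
    refine List.ext_getElem (by simp [hw]) fun t h1 h2 => ?_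
    rw [getElem_window, h t h2]

lemma window_shift (x : ℤ → A) (i : ℤ) (n : ℕ) : window (shift x) i n = window x (i + 1) n := by
  unfold window shift
  congr 1
  ext t
  congr 1
  ring

lemma window_add (x : ℤ → A) (i : ℤ) (m n : ℕ) :
    window x i (m + n) = window x i m ++ window x (i + m) n := by
  refine List.ext_getElem (by simp) fun t h1 h2 => ?_
  rw [getElem_window, List.getElem_append]
  split_ifs with h
  · rw [getElem_window]
  · rw [getElem_window]
    congr 1
    rw [length_window] at h ⊢
    push_cast [not_lt.1 h]
    ring

lemma take_window (x : ℤ → A) (i : ℤ) {m n : ℕ} (h : m ≤ n) :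
    (window x i n).take m = window x i m := by
  obtain ⟨k, rfl⟩ := Nat.exists_eq_add_of_le h
  rw [window_add, List.take_append_of_le_length (by simp), List.take_of_length_le (by simp)]

lemma drop_window (x : ℤ → A) (i : ℤ) {m n : ℕ} (h : m ≤ n) :
    (window x i n).drop m = window x (i + m) (n - m) := by
  obtain ⟨k, rfl⟩ := Nat.exists_eq_add_of_le h
  rw [window_add, List.drop_left' (by simp), Nat.add_sub_cancel_left]

lemma window_neg (x : ℤ → A) (i : ℤ) (n : ℕ) :
    window (fun k => x (-k)) i n = (window x (1 - i - n) n).reverse := by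
  refine List.ext_getElem (by simp) fun t h1 h2 => ?_
  rw [getElem_window, List.getElem_reverse, getElem_window]
  congr 1
  rw [length_window] at h1 ⊢
  rw [Nat.cast_sub (by omega), Nat.cast_sub (by omega)]
  push_cast
  ring

lemma mem_cylinder_iff {x : ℤ → A} {w : List A} :
    x ∈ _root_.cylinder w ↔ window x 0 w.length = w := by
  rw [window_eq_iff rfl]
  simp [_root_.cylinder]

lemma cylinder_eq {w : List A} {n : ℕ} (hw : w.length = n) :
    _root_.cylinder w = {x | window x 0 n = w} := by
  subst hw
  ext x
  exact mem_cylinder_iff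

lemma factorOf_iff {x : ℤ → A} {w : List A} : FactorOf w x ↔ ∃ i, window x i w.length = w := by
  simp only [window_eq_iff rfl]
  rfl

lemma mem_betaFree_iff {d : ℕ} {β : ℝ} {x : ℤ → Fin d} :
    x ∈ betaFree d β ↔ ∀ i n, IsFree β (window x i n) := by
  constructor
  · intro hx i n u hu ℓ hℓ
    refine hx u ?_ ℓ hℓ
    obtain ⟨p, q, h⟩ := hu
    have hl := congrArg List.length h
    simp only [List.length_append, length_window] at hl
    refine factorOf_iff.2 ⟨i + p.length, ?_⟩
    rw [← hl, add_assoc, window_add, List.append_assoc] at h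
    have h2 := (List.append_inj h (by simp)).2
    rw [window_add] at h2
    exact (List.append_inj h2 (by simp)).1.symm
  · intro hx w hw ℓ hℓ
    obtain ⟨i, hi⟩ := factorOf_iff.1 hw
    exact hx i w.length w (by rw [hi]) ℓ hℓ

end Window

section Measure

variable {A : Type*} [Fintype A] [MeasurableSpace A] [MeasurableSingletonClass A]

lemma measurable_shift {A : Type*} [MeasurableSpace A] :
    Measurable (shift : (ℤ → A) → ℤ → A) :=
  measurable_pi_lambda _ fun n => measurable_pi_apply (n + 1)

lemma measurableSet_window (i : ℤ) (n : ℕ) (Q : List A → Prop) :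
    MeasurableSet {x : ℤ → A | Q (window x i n)} := by
  have h : Measurable fun (x : ℤ → A) (t : Fin n) => x (i + (t : ℕ)) :=
    measurable_pi_lambda _ fun t => measurable_pi_apply _
  exact h (t := {v | Q (List.ofFn v)}) (Set.toFinite _).measurableSet

lemma IsShiftInvariant.measure_window {μ : Measure (ℤ → A)} (hμ : IsShiftInvariant μ) (i : ℤ)
    (n : ℕ) (Q : List A → Prop) :
    μ {x | Q (window x i n)} = μ {x | Q (window x 0 n)} := by
  have step : ∀ i, μ {x | Q (window x (i + 1) n)} = μ {x | Q (window x i n)} := by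
    intro i
    rw [← hμ _ (measurableSet_window i n Q)]
    congr 1
    ext x
    simp only [mem_preimage, mem_ofPred_eq, window_shift]
  induction i using Int.induction_on with
  | zero => rfl
  | succ k ih => rw [step, ih]
  | pred k ih => rw [← step, sub_add_cancel, ih]

lemma IsShiftInvariant.measureReal_window {μ : Measure (ℤ → A)} (hμ : IsShiftInvariant μ) (i : ℤ)
    (n : ℕ) (Q : List A → Prop) :
    μ.real {x | Q (window x i n)} = μ.real {x | Q (window x 0 n)} := by
  rw [measureReal_def, hμ.measure_window, measureReal_def]

/-- An invariant measure on sequences of `β`-free words such that all sets of words of substantial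
measure contain a substantial proportion of the free words. -/
structure IsSpread (β : ℝ) (μ : Measure (ℤ → A)) : Prop where
  invariant : IsShiftInvariant μ
  free : ∀ᵐ x ∂μ, ∀ i n, IsFree β (window x i n)
  exists_le_card : ∀ α : ℝ, 0 < α → ∃ c : ℝ, 0 < c ∧ ∀ n, ∀ D ⊆ words A n,
    α ≤ μ.real {x | window x 0 n ∈ D} → c * (freeWords A β n).card ≤ D.card

lemma IsSpread.exists_le_measureReal_suffix {β : ℝ} (hβ : 12 < β) (hA : 2 ≤ Fintype.card A)
    {μ : Measure (ℤ → A)} [IsFiniteMeasure μ] (hμ : IsSpread β μ) (h0 : μ ≠ 0) :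
    ∃ p : ℝ, 0 < p ∧ ∀ m, p ≤ μ.real {x | NoFourthPowerSuffix (window x 0 m)} := by
  have ht : 0 < μ.real univ := by
    rw [measureReal_def]
    exact ENNReal.toReal_pos (by simpa using h0) (measure_ne_top _ _)
  set t := μ.real univ with htdef
  obtain ⟨c, hc, hcard⟩ := hμ.exists_le_card (t / 2) (by positivity)
  obtain ⟨J, hJ⟩ := exists_pow_lt_of_lt_one hc (show (6 / 7 : ℝ) < 1 by norm_num)
  have hJ0 : (0 : ℝ) < J + 1 := by positivity
  refine ⟨t / 2 / (J + 1), by positivity, fun m => ?_⟩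
  set g := μ.real {x | NoFourthPowerSuffix (window x 0 m)} with hg
  set n := m + J with hn
  have hbad : μ.real {x | window x 0 n ∈ unstableWords A β n J} < t / 2 := by
    by_contra! hle
    have h1 := hcard n (unstableWords A β n J)
      (fun w hw => by
        simp only [unstableWords, Finset.mem_filter, mem_freeWords] at hw
        exact mem_words.2 hw.1.1) hle
    have h2 := card_unstableWords_le (A := A) hβ hA n J
    have h3 : (0 : ℝ) < (freeWords A β n).card := by exact_mod_cast card_freeWords_pos hβ hA n
    have := mul_lt_mul_of_pos_right hJ h3
    linarith
  have hgood : ∀ a < J, μ.real {x | NoFourthPowerSuffix (window x 0 (n - a))} ≤ g := by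
    intro a ha
    rw [hg, ← hμ.invariant.measureReal_window ((J - a : ℕ) : ℤ) m]
    refine measureReal_mono fun x hx => ?_
    have hx' : NoFourthPowerSuffix (window x 0 (n - a)) := hx
    refine hx'.suffix ?_
    have := drop_window x 0 (m := J - a) (n := n - a) (by omega)
    rw [zero_add, show n - a - (J - a) = m by omega] at this
    rw [← this]
    exact List.drop_suffix _ _
  have hcover : t ≤ μ.real ({x | window x 0 n ∈ unstableWords A β n J} ∪
      ⋃ a ∈ Finset.range J, {x | NoFourthPowerSuffix (window x 0 (n - a))}) := by
    rw [htdef]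
    have hae : (univ : Set (ℤ → A)) ≤ᵐ[μ]
        ({x | window x 0 n ∈ unstableWords A β n J} ∪
          ⋃ a ∈ Finset.range J, {x | NoFourthPowerSuffix (window x 0 (n - a))} : Set (ℤ → A)) := by
      filter_upwards [hμ.free] with x hx _
      by_cases h : window x 0 n ∈ unstableWords A β n J
      · exact Or.inl h
      · right
        simp only [unstableWords, Finset.mem_filter, mem_freeWords, length_window, true_and,
          hx 0 n, not_forall, not_not] at h
        obtain ⟨a, ha, h⟩ := h
        rw [take_window _ _ (by omega)] at h
        simp only [mem_iUnion]
        exact ⟨a, Finset.mem_range.2 ha, h⟩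
    exact ENNReal.toReal_mono (measure_ne_top _ _) (measure_mono_ae hae)
  have hsum : μ.real (⋃ a ∈ Finset.range J, {x | NoFourthPowerSuffix (window x 0 (n - a))}) ≤
      J * g := by
    refine (measureReal_biUnion_finset_le _ _).trans ?_
    refine (Finset.sum_le_card_nsmul _ _ g fun a ha => hgood a (Finset.mem_range.1 ha)).trans ?_
    simp
  have := measureReal_union_le (μ := μ) {x | window x 0 n ∈ unstableWords A β n J}
    (⋃ a ∈ Finset.range J, {x | NoFourthPowerSuffix (window x 0 (n - a))})
  have hg0 : 0 ≤ g := measureReal_nonneg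
  rw [div_le_iff₀ hJ0]
  linarith

lemma IsSpread.map_neg {β : ℝ} {μ : Measure (ℤ → A)} (hμ : IsSpread β μ) :
    IsSpread β (μ.map fun x k => x (-k)) := by
  classical
  have hneg : Measurable fun (x : ℤ → A) (k : ℤ) => x (-k) :=
    measurable_pi_lambda _ fun k => measurable_pi_apply (-k)
  have hback : Measurable fun (x : ℤ → A) (k : ℤ) => x (k - 1) :=
    measurable_pi_lambda _ fun k => measurable_pi_apply (k - 1)
  refine ⟨fun E hE => ?_, ?_, fun α hα => ?_⟩
  · rw [Measure.map_apply hneg (measurable_shift hE), Measure.map_apply hneg hE,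
      ← hμ.invariant _ (hneg (measurable_shift hE))]
    congr 1
    ext x
    simp only [mem_preimage]
    refine iff_of_eq (congrArg (· ∈ E) ?_)
    ext k
    simp only [shift]
    congr 1
    ring
  · have hset : ∀ (i : ℤ) (n : ℕ), MeasurableSet {x : ℤ → A | IsFree β (window x i n)} :=
      fun i n => measurableSet_window i n _
    simp only [ae_all_iff]
    intro i n
    rw [ae_map_iff hneg.aemeasurable (hset i n)]
    filter_upwards [hμ.free] with x hx
    rw [window_neg]
    exact (hx _ _).reverse
  · obtain ⟨c, hc, h⟩ := hμ.exists_le_card α hα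
    refine ⟨c, hc, fun n D hD hle => ?_⟩
    rw [← Finset.card_image_of_injective D List.reverse_injective]
    refine h n _ (fun w hw => ?_) (hle.trans_eq ?_)
    · obtain ⟨v, hv, rfl⟩ := Finset.mem_image.1 hw
      simpa using hD hv
    · rw [map_measureReal_apply hneg (measurableSet_window 0 n (· ∈ D)),
        ← hμ.invariant.measureReal_window (1 - 0 - n) n (· ∈ D.image List.reverse)]
      congr 1
      ext x
      simp only [mem_preimage, mem_ofPred_eq]
      rw [window_neg, Finset.mem_image]
      constructor
      · exact fun hx => ⟨_, hx, List.reverse_reverse _⟩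
      · rintro ⟨v, hv, hvx⟩
        rwa [← hvx, List.reverse_reverse]

lemma IsSpread.exists_le_measureReal_reverse {β : ℝ} (hβ : 12 < β) (hA : 2 ≤ Fintype.card A)
    {μ : Measure (ℤ → A)} [IsFiniteMeasure μ] (hμ : IsSpread β μ) (h0 : μ ≠ 0) :
    ∃ p : ℝ, 0 < p ∧ ∀ m, p ≤ μ.real {x | NoFourthPowerSuffix (window x 0 m).reverse} := by
  have hneg : Measurable fun (x : ℤ → A) (k : ℤ) => x (-k) :=
    measurable_pi_lambda _ fun k => measurable_pi_apply (-k)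
  have h0' : μ.map (fun x k => x (-k)) ≠ 0 := by
    rwa [Ne, Measure.map_eq_zero_iff hneg.aemeasurable]
  obtain ⟨p, hp, h⟩ := hμ.map_neg.exists_le_measureReal_suffix hβ hA h0'
  refine ⟨p, hp, fun m => (h m).trans_eq ?_⟩
  rw [map_measureReal_apply hneg (measurableSet_window 0 m _),
    ← hμ.invariant.measureReal_window (1 - 0 - m) m (fun w => NoFourthPowerSuffix w.reverse)]
  congr 1
  ext x
  simp only [mem_preimage, mem_ofPred_eq]
  rw [window_neg]

/-- Words of two distinguishable kinds can be concatenated with the switch at too many positions. -/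
lemma IsSpread.not_separated {β : ℝ} (hβ : 12 < β) (hA : 2 ≤ Fintype.card A)
    {μ ν : Measure (ℤ → A)} [IsFiniteMeasure μ] [IsFiniteMeasure ν] (hμ : IsSpread β μ)
    (hν : IsSpread β ν) (hμ0 : μ ≠ 0) (hν0 : ν ≠ 0)
    (hsep : ∀ ε : ℝ, 0 < ε → ∃ (m : ℕ) (P : Set (List A)),
      μ.real {x | window x 0 m ∈ P} ≤ ε ∧ ν.real {x | window x 0 m ∉ P} ≤ ε) : False := by
  classical
  obtain ⟨p, hp, hpμ⟩ := hμ.exists_le_measureReal_suffix hβ hA hμ0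
  obtain ⟨q, hq, hqν⟩ := hν.exists_le_measureReal_reverse hβ hA hν0
  obtain ⟨a, ha, haμ⟩ := hμ.exists_le_card (p / 2) (by positivity)
  obtain ⟨b, hb, hbν⟩ := hν.exists_le_card (q / 2) (by positivity)
  obtain ⟨R, hR⟩ := exists_nat_gt (1 / (a * b))
  have hab : 0 < a * b := by positivity
  have hR0 : (0 : ℝ) < R := lt_trans (by positivity) hR
  obtain ⟨m, P, hPμ, hPν⟩ := hsep (min (p / 2 / R) (q / 2)) (by positivity)
  let D : ℕ → Finset (List A) := fun i => (freeWords A β (i * m)).filter fun w =>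
    NoFourthPowerSuffix w ∧ ∀ k < i, (w.drop (k * m)).take m ∉ P
  let E : ℕ → Finset (List A) := fun i => (freeWords A β ((R - i) * m)).filter fun w =>
    NoFourthPowerSuffix w.reverse ∧ w.take m ∈ P
  have hD : ∀ i ≤ R, a * (freeWords A β (i * m)).card ≤ (D i).card := by
    intro i hi
    refine haμ _ _ (fun w hw => by
      simp only [D, Finset.mem_filter, mem_freeWords] at hw; exact mem_words.2 hw.1.1) ?_
    have hbadk : ∀ k, μ.real {x | window x ((k * m : ℕ) : ℤ) m ∈ P} ≤ p / 2 / R := fun k => by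
      rw [hμ.invariant.measureReal_window _ _ (· ∈ P)]
      exact hPμ.trans (min_le_left _ _)
    have hU : μ.real (⋃ k ∈ Finset.range i, {x | window x ((k * m : ℕ) : ℤ) m ∈ P}) ≤ p / 2 := by
      refine (measureReal_biUnion_finset_le _ _).trans ?_
      refine (Finset.sum_le_card_nsmul _ _ _ fun k _ => hbadk k).trans ?_
      rw [Finset.card_range, nsmul_eq_mul]
      have : (i : ℝ) ≤ R := by exact_mod_cast hi
      calc (i : ℝ) * (p / 2 / R) ≤ R * (p / 2 / R) := by gcongr
        _ = p / 2 := by field_simp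
    have hcov : μ.real {x | NoFourthPowerSuffix (window x 0 (i * m))} ≤
        μ.real ({x | window x 0 (i * m) ∈ D i} ∪
          ⋃ k ∈ Finset.range i, {x | window x ((k * m : ℕ) : ℤ) m ∈ P}) := by
      refine ENNReal.toReal_mono (measure_ne_top _ _) (measure_mono_ae ?_)
      filter_upwards [hμ.free] with x hx hxs
      by_cases h : ∃ k < i, window x ((k * m : ℕ) : ℤ) m ∈ P
      · obtain ⟨k, hk, h⟩ := h
        right
        simp only [mem_iUnion]
        exact ⟨k, Finset.mem_range.2 hk, h⟩
      · left
        push Not at h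
        refine Finset.mem_filter.2 ⟨mem_freeWords.2 ⟨length_window _ _ _, hx _ _⟩, hxs,
          fun k hk => ?_⟩
        have hkm : (k + 1) * m ≤ i * m := Nat.mul_le_mul_right m hk
        rw [add_mul, one_mul] at hkm
        rw [drop_window _ _ (by omega), take_window _ _ (by omega), zero_add]
        exact h k hk
    have := measureReal_union_le (μ := μ) {x | window x 0 (i * m) ∈ D i}
      (⋃ k ∈ Finset.range i, {x | window x ((k * m : ℕ) : ℤ) m ∈ P})
    linarith [hpμ (i * m)]
  have hE : ∀ i < R, b * (freeWords A β ((R - i) * m)).card ≤ (E i).card := by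
    intro i hi
    refine hbν _ _ (fun w hw => by
      simp only [E, Finset.mem_filter, mem_freeWords] at hw; exact mem_words.2 hw.1.1) ?_
    have hcov : ν.real {x | NoFourthPowerSuffix (window x 0 ((R - i) * m)).reverse} ≤
        ν.real ({x | window x 0 ((R - i) * m) ∈ E i} ∪ {x | window x 0 m ∉ P}) := by
      refine ENNReal.toReal_mono (measure_ne_top _ _) (measure_mono_ae ?_)
      filter_upwards [hν.free] with x hx hxs
      by_cases h : window x 0 m ∈ P
      · left
        refine Finset.mem_filter.2 ⟨mem_freeWords.2 ⟨length_window _ _ _, hx _ _⟩, hxs, ?_⟩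
        rwa [take_window _ _ (Nat.le_mul_of_pos_left m (by omega))]
      · exact Or.inr h
    have := measureReal_union_le (μ := ν) {x | window x 0 ((R - i) * m) ∈ E i}
      {x | window x 0 m ∉ P}
    linarith [hqν ((R - i) * m), hPν.trans (min_le_right _ _)]
  have hDlen : ∀ i, ∀ w ∈ D i, w.length = i * m := fun i w hw =>
    (mem_freeWords.1 (Finset.mem_filter.1 hw).1).1
  let Z : ℕ → Finset (List A) := fun i => (D i ×ˢ E i).image fun r => r.1 ++ r.2
  have hZ : ∀ i < R, Z i ⊆ freeWords A β (R * m) := by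
    intro i hi w hw
    obtain ⟨⟨u, v⟩, h, rfl⟩ := Finset.mem_image.1 hw
    simp only [D, E, Finset.mem_product, Finset.mem_filter, mem_freeWords] at h
    obtain ⟨⟨⟨hul, hu⟩, hus, -⟩, ⟨hvl, hv⟩, hvs, -⟩ := h
    refine mem_freeWords.2 ⟨?_, hu.append hβ hv hus hvs⟩
    rw [List.length_append, hul, hvl, ← add_mul, Nat.add_sub_cancel' hi.le]
  have hdisj : ∀ i j, i < j → j < R → Disjoint (Z i) (Z j) := by
    intro i j hij hj
    rw [Finset.disjoint_left]
    intro w hw hw'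
    obtain ⟨⟨u, v⟩, h, rfl⟩ := Finset.mem_image.1 hw
    obtain ⟨⟨u', v'⟩, h', heq⟩ := Finset.mem_image.1 hw'
    rw [Finset.mem_product] at h h'
    have hul := hDlen _ _ h.1
    have hul' := hDlen _ _ h'.1
    have h1 : v.take m ∈ P := (Finset.mem_filter.1 h.2).2.2
    have h2 : (u'.drop (i * m)).take m ∉ P := (Finset.mem_filter.1 h'.1).2.2 i hij
    have hkm : (i + 1) * m ≤ j * m := Nat.mul_le_mul_right m hij
    rw [add_mul, one_mul] at hkm
    dsimp only at heq hul hul'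
    have := congrArg (fun l : List A => (l.drop (i * m)).take m) heq
    rw [List.drop_left' hul, List.drop_append_of_le_length (by omega),
      List.take_append_of_le_length (by rw [List.length_drop]; omega)] at this
    rw [this] at h2
    exact h2 h1
  have hcount : ∑ i ∈ Finset.range R, (Z i).card ≤ (freeWords A β (R * m)).card := by
    rw [← Finset.card_biUnion]
    · exact Finset.card_le_card
        (Finset.biUnion_subset.2 fun i hi => hZ i (Finset.mem_range.1 hi))
    · intro i hi j hj hij
      rw [Finset.mem_coe, Finset.mem_range] at hi hj
      rcases lt_or_gt_of_ne hij with h | h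
      · exact hdisj i j h hj
      · exact (hdisj j i h hi).symm
  have hlower : ∀ i ∈ Finset.range R, a * b * (freeWords A β (R * m)).card ≤ ((Z i).card : ℝ) := by
    intro i hi
    rw [Finset.mem_range] at hi
    have h1 := card_freeWords_add_le (A := A) β (i * m) ((R - i) * m)
    rw [← add_mul, Nat.add_sub_cancel' hi.le] at h1
    have h1' : ((freeWords A β (R * m)).card : ℝ) ≤
        (freeWords A β (i * m)).card * (freeWords A β ((R - i) * m)).card := by exact_mod_cast h1
    rw [show (Z i).card = (D i).card * (E i).card from card_image_append (hDlen i)]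
    push_cast
    calc a * b * ((freeWords A β (R * m)).card : ℝ)
        ≤ a * b * ((freeWords A β (i * m)).card * (freeWords A β ((R - i) * m)).card) := by
          gcongr
      _ = (a * (freeWords A β (i * m)).card) * (b * (freeWords A β ((R - i) * m)).card) := by ring
      _ ≤ _ := mul_le_mul (hD i hi.le) (hE i hi) (by positivity) (by positivity)
  have htotal : (R : ℝ) * (a * b * (freeWords A β (R * m)).card) ≤
      (freeWords A β (R * m)).card := by
    have h1 := Finset.card_nsmul_le_sum _ _ _ hlower
    rw [Finset.card_range, nsmul_eq_mul] at h1
    exact h1.trans (by exact_mod_cast hcount)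
  have hpos : (0 : ℝ) < (freeWords A β (R * m)).card := by
    exact_mod_cast card_freeWords_pos hβ hA (R * m)
  rw [div_lt_iff₀ hab] at hR
  nlinarith

end Measure

section WindowSets

variable {A : Type*}

/-- The sets of sequences determined by finitely many coordinates. -/
def windowSets (A : Type*) : Set (Set (ℤ → A)) :=
  {E | ∃ (k : ℕ) (Q : List A → Prop), E = {x | Q (window x (-k) (2 * k))}}

lemma mem_windowSets_of_le {Q : List A → Prop} {k l : ℕ} (h : k ≤ l) :
    ∃ Q' : List A → Prop,
      {x : ℤ → A | Q (window x (-k) (2 * k))} = {x | Q' (window x (-l) (2 * l))} := by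
  refine ⟨fun w => Q ((w.drop (l - k)).take (2 * k)), ?_⟩
  ext x
  simp only [mem_ofPred_eq]
  rw [drop_window _ _ (by omega), take_window _ _ (by omega)]
  push_cast [h]
  rw [show -(l : ℤ) + (l - k) = -k by ring]

lemma isSetRing_windowSets : IsSetRing (windowSets A) where
  empty_mem := ⟨0, fun _ => False, by simp⟩
  union_mem := by
    rintro _ _ ⟨k, Q, rfl⟩ ⟨l, R, rfl⟩
    obtain ⟨Q', hQ⟩ := mem_windowSets_of_le (Q := Q) (le_max_left k l)
    obtain ⟨R', hR⟩ := mem_windowSets_of_le (Q := R) (le_max_right k l)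
    exact ⟨max k l, fun w => Q' w ∨ R' w, by rw [hQ, hR]; rfl⟩
  sdiff_mem := by
    rintro _ _ ⟨k, Q, rfl⟩ ⟨l, R, rfl⟩
    obtain ⟨Q', hQ⟩ := mem_windowSets_of_le (Q := Q) (le_max_left k l)
    obtain ⟨R', hR⟩ := mem_windowSets_of_le (Q := R) (le_max_right k l)
    exact ⟨max k l, fun w => Q' w ∧ ¬ R' w, by rw [hQ, hR]; rfl⟩

lemma univ_mem_windowSets : univ ∈ windowSets A := ⟨0, fun _ => True, by simp⟩

lemma eval_preimage_mem_windowSets (n : ℤ) (s : Set A) :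
    (fun x : ℤ → A => x n) ⁻¹' s ∈ windowSets A := by
  obtain ⟨t, ht⟩ : ∃ t : ℕ, (t : ℤ) = n + (n.natAbs + 1 : ℕ) :=
    ⟨(n + (n.natAbs + 1 : ℕ)).toNat, by omega⟩
  have htl : t < 2 * (n.natAbs + 1) := by omega
  refine ⟨n.natAbs + 1, fun w => ∃ a ∈ s, w[t]? = some a, ?_⟩
  ext x
  have : (window x (-(n.natAbs + 1 : ℕ)) (2 * (n.natAbs + 1)))[t]? = some (x n) := by
    rw [List.getElem?_eq_getElem (by simpa using htl), getElem_window, ht]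
    congr 2
    ring
  simp only [mem_preimage, mem_ofPred_eq, this, Option.some.injEq]
  exact ⟨fun h => ⟨_, h, rfl⟩, fun ⟨a, ha, h⟩ => h ▸ ha⟩

variable [Fintype A] [MeasurableSpace A] [MeasurableSingletonClass A]

lemma measurableSet_of_mem_windowSets {E : Set (ℤ → A)} (hE : E ∈ windowSets A) :
    MeasurableSet E := by
  obtain ⟨k, Q, rfl⟩ := hE
  exact measurableSet_window _ _ _

lemma generateFrom_windowSets :
    (MeasurableSpace.pi : MeasurableSpace (ℤ → A)) =
      MeasurableSpace.generateFrom (windowSets A) := by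
  refine le_antisymm (iSup_le fun n => ?_)
    (MeasurableSpace.generateFrom_le fun E hE => measurableSet_of_mem_windowSets hE)
  rintro _ ⟨s, -, rfl⟩
  exact MeasurableSpace.measurableSet_generateFrom (eval_preimage_mem_windowSets n s)

end WindowSets

section Separation

variable {A : Type*} [MeasurableSpace A]

lemma isShiftInvariant_iff_map {μ : Measure (ℤ → A)} :
    IsShiftInvariant μ ↔ μ.map shift = μ := by
  constructor
  · intro h
    ext E hE
    rw [Measure.map_apply measurable_shift hE, h E hE]
  · intro h E hE
    rw [← Measure.map_apply measurable_shift hE, h]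

lemma measure_le_sub_add {Ω : Type*} [MeasurableSpace Ω] (μ ν : Measure Ω) [IsFiniteMeasure μ]
    [IsFiniteMeasure ν] : μ ≤ μ - ν + ν :=
  Measure.sub_le_iff_le_add.1 le_rfl

lemma IsShiftInvariant.sub {μ ν : Measure (ℤ → A)} [IsFiniteMeasure μ] [IsFiniteMeasure ν]
    (hμ : IsShiftInvariant μ) (hν : IsShiftInvariant ν) : IsShiftInvariant (μ - ν) := by
  rw [isShiftInvariant_iff_map] at *
  refine (Measure.eq_of_le_of_measure_univ_eq (Measure.sub_le_of_le_add ?_) ?_).symm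
  · have := Measure.map_mono (measure_le_sub_add μ ν) measurable_shift
    rwa [Measure.map_add _ _ measurable_shift, hμ, hν] at this
  · rw [Measure.map_apply measurable_shift MeasurableSet.univ, preimage_univ]

variable [Fintype A]

lemma IsSpread.mono {β : ℝ} {μ μ' : Measure (ℤ → A)} [IsFiniteMeasure μ] (hμ : IsSpread β μ)
    (h : μ' ≤ μ) (hinv : IsShiftInvariant μ') : IsSpread β μ' := by
  refine ⟨hinv, Measure.absolutelyContinuous_of_le h hμ.free, fun α hα => ?_⟩
  obtain ⟨c, hc, hcard⟩ := hμ.exists_le_card α hα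
  exact ⟨c, hc, fun n D hD hle => hcard n D hD
    (hle.trans (ENNReal.toReal_mono (measure_ne_top _ _) (h _)))⟩

variable [MeasurableSingletonClass A]

lemma exists_window_separating {μ ν : Measure (ℤ → A)} [IsFiniteMeasure μ] [IsFiniteMeasure ν]
    (hμ : IsShiftInvariant μ) (hν : IsShiftInvariant ν) (h : μ.MutuallySingular ν) {ε : ℝ}
    (hε : 0 < ε) : ∃ (m : ℕ) (P : Set (List A)),
      μ.real {x | window x 0 m ∈ P} ≤ ε ∧ ν.real {x | window x 0 m ∉ P} ≤ ε := by
  obtain ⟨S, hS, hμS, hνS⟩ := h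
  obtain ⟨_, ⟨k, Q, rfl⟩, hE⟩ := exists_measure_symmDiff_lt_of_generateFrom_isSetRing
    (μ := μ + ν) isSetRing_windowSets
    ⟨{univ}, countable_singleton _, by simpa using univ_mem_windowSets, by simp⟩
    generateFrom_windowSets hS (ENNReal.ofReal_pos.2 hε)
  rw [Measure.add_apply] at hE
  refine ⟨2 * k, {w | Q w}, ?_, ?_⟩
  · rw [← hμ.measureReal_window (-k)]
    refine ENNReal.toReal_le_of_le_ofReal hε.le ?_
    refine le_trans ?_ (le_self_add.trans hE.le)
    refine (measure_mono (t := {x | Q (window x (-k) (2 * k))} \ S ∪ S) ?_).trans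
      ((measure_union_le _ _).trans ?_)
    · intro x hx
      by_cases hxS : x ∈ S
      · exact Or.inr hxS
      · exact Or.inl ⟨hx, hxS⟩
    · rw [hμS, add_zero]
      exact measure_mono fun x hx => Or.inl hx
  · rw [← hν.measureReal_window (-k) _ (· ∉ {w | Q w})]
    refine ENNReal.toReal_le_of_le_ofReal hε.le ?_
    refine le_trans ?_ (le_add_self.trans hE.le)
    refine (measure_mono (t := S \ {x | Q (window x (-k) (2 * k))} ∪ Sᶜ) ?_).trans
      ((measure_union_le _ _).trans ?_)
    · intro x hx
      by_cases hxS : x ∈ S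
      · exact Or.inl ⟨hxS, hx⟩
      · exact Or.inr hxS
    · rw [hνS, add_zero]
      exact measure_mono fun x hx => Or.inr hx

lemma IsSpread.eq {β : ℝ} (hβ : 12 < β) (hA : 2 ≤ Fintype.card A) {μ ν : Measure (ℤ → A)}
    [IsProbabilityMeasure μ] [IsProbabilityMeasure ν] (hμ : IsSpread β μ) (hν : IsSpread β ν) :
    μ = ν := by
  have hne : ∀ {μ ν : Measure (ℤ → A)} [IsProbabilityMeasure μ] [IsProbabilityMeasure ν],
      μ ≠ ν → μ - ν ≠ 0 := by
    intro μ ν _ _ h h0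
    have := measure_le_sub_add μ ν
    rw [h0, zero_add] at this
    exact h (Measure.eq_of_le_of_isProbabilityMeasure this)
  by_contra h
  have hinv := hμ.invariant.sub hν.invariant
  have hinv' := hν.invariant.sub hμ.invariant
  exact (hμ.mono Measure.sub_le hinv).not_separated hβ hA (hν.mono Measure.sub_le hinv') (hne h)
    (hne (Ne.symm h)) fun ε hε =>
      exists_window_separating hinv hinv' Measure.mutually_singular_measure_sub hε

end Separation

lemma negMulLog_le {p q : ℝ} (hp : 0 ≤ p) (hq : 0 ≤ q) (hpq : q = 0 → p = 0) :
    negMulLog p ≤ p * -log q + (q - p) := by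
  rcases hp.eq_or_lt with rfl | hp
  · simpa using hq
  · have hq' : 0 < q := lt_of_le_of_ne hq fun h => hp.ne' (hpq h.symm)
    have h := mul_le_mul_of_nonneg_left (log_le_sub_one_of_pos (div_pos hq' hp)) hp.le
    rw [log_div hq'.ne' hp.ne', mul_sub p (q / p), mul_div_cancel₀ _ hp.ne'] at h
    rw [negMulLog]
    linarith

section WordEntropy

variable {A : Type*} [Fintype A] [MeasurableSpace A]

/-- The Shannon entropy of the word of length `n` at the origin. -/
noncomputable def wordEntropy (μ : Measure (ℤ → A)) (n : ℕ) : ℝ :=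
  ∑ w ∈ words A n, negMulLog (μ.real {x | window x 0 n = w})

lemma cylEntropySum_eq (μ : Measure (ℤ → A)) (n : ℕ) : cylEntropySum μ n = wordEntropy μ n := by
  refine Finset.sum_bij (fun w _ => List.ofFn w) (fun w _ => by simp)
    (fun v _ w _ h => List.ofFn_injective h) (fun w hw => ?_) fun w _ => ?_
  · rw [mem_words] at hw
    subst hw
    exact ⟨w.get, Finset.mem_univ _, List.ofFn_get w⟩
  · rw [cylinder_eq (List.length_ofFn), measureReal_def]

lemma wordEntropy_nonneg (μ : Measure (ℤ → A)) [IsProbabilityMeasure μ] (n : ℕ) :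
    0 ≤ wordEntropy μ n :=
  Finset.sum_nonneg fun _ _ => negMulLog_nonneg measureReal_nonneg measureReal_le_one

lemma wordEntropy_eq_sum {μ : Measure (ℤ → A)} [IsProbabilityMeasure μ] {n : ℕ}
    {S : Finset (List A)} (hSn : S ⊆ words A n) (hS : ∀ᵐ x ∂μ, window x 0 n ∈ S) :
    wordEntropy μ n = ∑ w ∈ S, negMulLog (μ.real {x | window x 0 n = w}) := by
  refine (Finset.sum_subset hSn fun w _ hw => ?_).symm
  have : μ {x | window x 0 n = w} = 0 := by
    refine measure_mono_null (fun x hx => ?_) hS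
    rw [mem_ofPred_eq] at hx
    simpa [hx] using hw
  rw [measureReal_def, this, ENNReal.toReal_zero, negMulLog_zero]

variable [MeasurableSingletonClass A]

lemma measureReal_window_mem (μ : Measure (ℤ → A)) [IsFiniteMeasure μ] (i : ℤ) (n : ℕ)
    (D : Finset (List A)) :
    μ.real {x | window x i n ∈ D} = ∑ w ∈ D, μ.real {x | window x i n = w} := by
  rw [← measureReal_biUnion_finset]
  · congr 1
    ext x
    simp
  · intro v _ w _ hvw
    refine Set.disjoint_left.2 fun x hx hx' => hvw ?_
    rw [mem_ofPred_eq] at hx hx'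
    rw [← hx, hx']
  · exact fun w _ => measurableSet_window i n (· = w)

lemma sum_measureReal_window (μ : Measure (ℤ → A)) [IsProbabilityMeasure μ] {n : ℕ}
    {S : Finset (List A)} (hS : ∀ᵐ x ∂μ, window x 0 n ∈ S) :
    ∑ w ∈ S, μ.real {x | window x 0 n = w} = 1 := by
  rw [← measureReal_window_mem, measureReal_def, measure_congr (eventuallyEq_univ.2 hS),
    measure_univ, ENNReal.toReal_one]

/-- Gibbs' inequality. -/
lemma wordEntropy_le_sum {μ : Measure (ℤ → A)} [IsProbabilityMeasure μ] {n : ℕ}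
    {S : Finset (List A)} (hSn : S ⊆ words A n) (hS : ∀ᵐ x ∂μ, window x 0 n ∈ S)
    {q : List A → ℝ} (hq0 : ∀ w ∈ S, 0 ≤ q w)
    (hpq : ∀ w ∈ S, q w = 0 → μ.real {x | window x 0 n = w} = 0) (hq : ∑ w ∈ S, q w ≤ 1) :
    wordEntropy μ n ≤ ∑ w ∈ S, μ.real {x | window x 0 n = w} * -log (q w) := by
  rw [wordEntropy_eq_sum hSn hS]
  have h := Finset.sum_le_sum fun w hw =>
    negMulLog_le (measureReal_nonneg (μ := μ) (s := {x | window x 0 n = w})) (hq0 w hw) (hpq w hw)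
  rw [Finset.sum_add_distrib, Finset.sum_sub_distrib, sum_measureReal_window μ hS] at h
  linarith

lemma wordEntropy_le_log_card {μ : Measure (ℤ → A)} [IsProbabilityMeasure μ] {n : ℕ}
    {S : Finset (List A)} (hSn : S ⊆ words A n) (hS : ∀ᵐ x ∂μ, window x 0 n ∈ S) :
    wordEntropy μ n ≤ log S.card := by
  have hpos : (0 : ℝ) < S.card := by
    obtain ⟨x, hx⟩ := hS.exists
    exact_mod_cast Finset.card_pos.2 ⟨_, hx⟩
  refine (wordEntropy_le_sum hSn hS (q := fun _ => (S.card : ℝ)⁻¹) (fun _ _ => by positivity)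
    (fun _ _ h => absurd h (by positivity)) ?_).trans_eq ?_
  · rw [Finset.sum_const, nsmul_eq_mul, mul_inv_cancel₀ hpos.ne']
  · rw [← Finset.sum_mul, sum_measureReal_window μ hS, log_inv, neg_neg, one_mul]

lemma log_sub_le_wordEntropy {μ : Measure (ℤ → A)} [IsProbabilityMeasure μ] {n : ℕ} {r : ℝ}
    (h : ∀ w, w.length = n → μ.real {x | window x 0 n = w} ≤ r) :
    -log r ≤ wordEntropy μ n := by
  have hall : ∀ᵐ x ∂μ, window x 0 n ∈ words A n := by simp
  calc -log r = ∑ w ∈ words A n, μ.real {x | window x 0 n = w} * -log r := by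
        rw [← Finset.sum_mul, sum_measureReal_window μ hall, one_mul]
    _ ≤ wordEntropy μ n := by
        refine Finset.sum_le_sum fun w hw => ?_
        rcases (measureReal_nonneg (μ := μ) (s := {x | window x 0 n = w})).eq_or_lt with h0 | h0
        · rw [← h0]
          simp
        · rw [negMulLog, neg_mul, mul_neg, neg_le_neg_iff]
          exact mul_le_mul_of_nonneg_left (log_le_log h0 (h w (mem_words.1 hw))) h0.le

lemma IsShiftInvariant.subadditive_wordEntropy {μ : Measure (ℤ → A)} [IsProbabilityMeasure μ]
    (hμ : IsShiftInvariant μ) : Subadditive (wordEntropy μ) := by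
  intro m n
  have hwords : ∀ k, ∀ᵐ x ∂μ, window x 0 k ∈ words A k := fun k => by simp
  set p : ℕ → List A → ℝ := fun k w => μ.real {x | window x 0 k = w} with hp
  have hp0 : ∀ k w, 0 ≤ p k w := fun _ _ => measureReal_nonneg
  have hp1 : ∀ k, ∑ w ∈ words A k, p k w = 1 := fun k => sum_measureReal_window μ (hwords k)
  have hbij : ∀ g : List A → List A → ℝ, ∑ w ∈ words A (m + n), g (w.take m) (w.drop m) =
      ∑ u ∈ words A m, ∑ v ∈ words A n, g u v := by
    intro g
    rw [← Finset.sum_product']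
    refine Finset.sum_bij' (fun w _ => (w.take m, w.drop m)) (fun r _ => r.1 ++ r.2) ?_ ?_ ?_ ?_ ?_
    · intro w hw
      simp only [mem_words, Finset.mem_product] at hw ⊢
      simp [hw]
    · intro r hr
      simp only [mem_words, Finset.mem_product] at hr ⊢
      simp [hr]
    · simp
    · rintro ⟨u, v⟩ hr
      simp only [mem_words, Finset.mem_product] at hr
      simp [← hr.1]
    · simp
  have hsub1 : ∀ w, {x : ℤ → A | window x 0 (m + n) = w} ⊆ {x | window x 0 m = w.take m} := by
    rintro _ x rfl
    exact (take_window x 0 (Nat.le_add_right m n)).symm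
  have hsub2 : ∀ w, {x : ℤ → A | window x 0 (m + n) = w} ⊆ {x | window x m n = w.drop m} := by
    rintro _ x rfl
    rw [mem_ofPred_eq, drop_window x 0 (Nat.le_add_right m n), zero_add, Nat.add_sub_cancel_left]
  have hle1 : ∀ w, p (m + n) w ≤ p m (w.take m) := fun w => measureReal_mono (hsub1 w)
  have hle2 : ∀ w, p (m + n) w ≤ p n (w.drop m) := fun w =>
    (measureReal_mono (hsub2 w)).trans_eq (hμ.measureReal_window m n (· = w.drop m))
  have hmarg1 : ∀ u ∈ words A m, ∑ v ∈ words A n, p (m + n) (u ++ v) = p m u := by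
    intro u hu
    rw [mem_words] at hu
    have h1 : {x : ℤ → A | window x 0 m = u} =
        {x | window x 0 (m + n) ∈ (words A n).map ⟨(u ++ ·), List.append_right_injective u⟩} := by
      ext x
      simp only [mem_ofPred_eq, Finset.mem_map, mem_words, Function.Embedding.coeFn_mk]
      rw [window_add]
      constructor
      · rintro rfl
        exact ⟨_, length_window _ _ _, rfl⟩
      · rintro ⟨v, -, hv⟩
        exact (List.append_inj hv (by simp [hu])).1.symm
    simp only [hp]
    rw [h1, measureReal_window_mem, Finset.sum_map]
    rfl
  have hmarg2 : ∀ v ∈ words A n, ∑ u ∈ words A m, p (m + n) (u ++ v) = p n v := by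
    intro v hv
    rw [mem_words] at hv
    have h1 : {x : ℤ → A | window x m n = v} =
        {x | window x 0 (m + n) ∈ (words A m).map ⟨(· ++ v), List.append_left_injective v⟩} := by
      ext x
      simp only [mem_ofPred_eq, Finset.mem_map, mem_words, Function.Embedding.coeFn_mk]
      rw [window_add, zero_add]
      constructor
      · rintro rfl
        exact ⟨_, length_window _ _ _, rfl⟩
      · rintro ⟨u, hu, hv⟩
        exact (List.append_inj hv (by simp [hu])).2.symm
    simp only [hp]
    rw [← hμ.measureReal_window m n (· = v), h1, measureReal_window_mem, Finset.sum_map]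
    rfl
  have hgibbs := wordEntropy_le_sum (μ := μ) (subset_refl (words A (m + n))) (hwords _)
    (q := fun w => p m (w.take m) * p n (w.drop m)) (fun w _ => mul_nonneg (hp0 _ _) (hp0 _ _))
    (fun w _ h => by
      rcases mul_eq_zero.1 h with h | h
      · exact le_antisymm ((hle1 w).trans_eq h) measureReal_nonneg
      · exact le_antisymm ((hle2 w).trans_eq h) measureReal_nonneg)
    (by
      rw [hbij fun u v => p m u * p n v]
      simp_rw [← Finset.mul_sum, hp1, mul_one, hp1, le_refl])
  refine hgibbs.trans_eq ?_
  have hsplit : ∀ w ∈ words A (m + n),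
      p (m + n) w * -log (p m (w.take m) * p n (w.drop m)) =
        p (m + n) (w.take m ++ w.drop m) * -log (p m (w.take m)) +
          p (m + n) (w.take m ++ w.drop m) * -log (p n (w.drop m)) := by
    intro w _
    rw [List.take_append_drop]
    rcases (hp0 (m + n) w).eq_or_lt with h | h
    · simp [← h]
    · rw [log_mul (h.trans_le (hle1 w)).ne' (h.trans_le (hle2 w)).ne']
      ring
  rw [Finset.sum_congr rfl hsplit, hbij fun u v => p (m + n) (u ++ v) * -log (p m u) +
    p (m + n) (u ++ v) * -log (p n v)]
  simp_rw [Finset.sum_add_distrib]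
  congr 1
  · refine Finset.sum_congr rfl fun u hu => ?_
    rw [← Finset.sum_mul, hmarg1 u hu, negMulLog]
    ring
  · rw [Finset.sum_comm]
    refine Finset.sum_congr rfl fun v hv => ?_
    rw [← Finset.sum_mul, hmarg2 v hv, negMulLog]
    ring

lemma IsSpread.of_wordEntropy {β : ℝ} (hβ : 12 < β) (hA : 2 ≤ Fintype.card A)
    {μ : Measure (ℤ → A)} [IsProbabilityMeasure μ] (hμ : IsShiftInvariant μ)
    (hfree : ∀ᵐ x ∂μ, ∀ i n, IsFree β (window x i n)) {K : ℝ}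
    (hK : ∀ n, log (freeWords A β n).card - K ≤ wordEntropy μ n) : IsSpread β μ := by
  classical
  refine ⟨hμ, hfree, fun α hα => ⟨exp (-(max 0 (K + log 2) / α)), exp_pos _, fun n D hD hle => ?_⟩⟩
  set F := freeWords A β n with hF
  have hFae : ∀ᵐ x ∂μ, window x 0 n ∈ F := by
    filter_upwards [hfree] with x hx
    exact mem_freeWords.2 ⟨length_window _ _ _, hx 0 n⟩
  have hFn : F ⊆ words A n := fun w hw => mem_words.2 (mem_freeWords.1 hw).1
  set E := F ∩ D with hE
  set a := μ.real {x | window x 0 n ∈ E} with ha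
  have haα : α ≤ a := by
    refine hle.trans (ENNReal.toReal_mono (measure_ne_top _ _) (measure_mono_ae ?_))
    filter_upwards [hFae] with x hx hxD
    exact Finset.mem_inter.2 ⟨hx, hxD⟩
  have hFpos : (0 : ℝ) < F.card := by exact_mod_cast card_freeWords_pos hβ hA n
  have hEpos : (0 : ℝ) < E.card := by
    rw [Nat.cast_pos, Finset.card_pos, Finset.nonempty_iff_ne_empty]
    intro h
    rw [ha, h] at haα
    simp at haα
    linarith
  have hEF : E.card ≤ F.card := Finset.card_le_card Finset.inter_subset_left
  have hlog : log E.card ≤ log F.card := log_le_log hEpos (by exact_mod_cast hEF)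
  have hsumE : ∑ w ∈ E, μ.real {x | window x 0 n = w} = a := (measureReal_window_mem _ _ _ _).symm
  have hsum : ∑ w ∈ F \ E, μ.real {x | window x 0 n = w} = 1 - a := by
    rw [← sum_measureReal_window μ hFae, ← hsumE,
      ← Finset.sum_sdiff (Finset.inter_subset_left : E ⊆ F), add_sub_cancel_right]
  have hgibbs := wordEntropy_le_sum hFn hFae
    (q := fun w => if w ∈ E then (2 * E.card : ℝ)⁻¹ else (2 * F.card : ℝ)⁻¹)
    (fun w _ => by split_ifs <;> positivity)
    (fun w _ h => by split_ifs at h <;> exact absurd h (by positivity))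
    (by
      rw [← Finset.sum_sdiff (Finset.inter_subset_left : E ⊆ F),
        Finset.sum_congr rfl fun w hw => if_neg (Finset.mem_sdiff.1 hw).2,
        Finset.sum_congr rfl fun w hw => if_pos hw, Finset.sum_const, Finset.sum_const,
        nsmul_eq_mul, nsmul_eq_mul]
      have h1 : ((F \ E).card : ℝ) ≤ F.card := by
        exact_mod_cast Finset.card_le_card Finset.sdiff_subset
      have h2 : ((F \ E).card : ℝ) * (2 * F.card : ℝ)⁻¹ ≤ 1 / 2 := by
        rw [← div_eq_mul_inv, div_le_iff₀ (by positivity)]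
        linarith
      have h3 : (E.card : ℝ) * (2 * E.card : ℝ)⁻¹ = 1 / 2 := by field_simp
      linarith)
  rw [← Finset.sum_sdiff (Finset.inter_subset_left : E ⊆ F),
    Finset.sum_congr rfl fun w hw => by rw [if_neg (Finset.mem_sdiff.1 hw).2],
    Finset.sum_congr rfl fun w (hw : w ∈ E) => by rw [if_pos hw], ← Finset.sum_mul,
    ← Finset.sum_mul, hsum, hsumE, log_inv, log_inv, log_mul two_ne_zero hFpos.ne',
    log_mul two_ne_zero hEpos.ne'] at hgibbs
  have hmain : a * (log F.card - log E.card) ≤ max 0 (K + log 2) :=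
    le_trans (by linarith [hK n]) (le_max_right _ _)
  have hαlog : log F.card - log E.card ≤ max 0 (K + log 2) / α := by
    rw [le_div_iff₀ hα, mul_comm]
    exact (mul_le_mul_of_nonneg_right haα (sub_nonneg.2 hlog)).trans hmain
  have hexp : exp (-(max 0 (K + log 2) / α)) * F.card ≤ E.card := by
    rw [← log_le_log_iff (by positivity) hEpos, log_mul (exp_pos _).ne' hFpos.ne', log_exp]
    linarith
  exact hexp.trans (by exact_mod_cast Finset.card_le_card Finset.inter_subset_right)

end WordEntropy

lemma exists_uniform_measure {ι Ω : Type*} [MeasurableSpace Ω] {S : Finset ι} (hS : S.Nonempty)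
    (y : ι → Ω) : ∃ ν : ProbabilityMeasure Ω, ∀ E, MeasurableSet E →
      (ν : Measure Ω).real E = (∑ r ∈ S, E.indicator (fun _ => (1 : ℝ)) (y r)) / S.card := by
  have hpos : (S.card : ENNReal) ≠ 0 := by simpa using hS.ne_empty
  have hval : ∀ E, MeasurableSet E → ((S.card : ENNReal)⁻¹ • ∑ r ∈ S, Measure.dirac (y r)) E =
      (S.card : ENNReal)⁻¹ * ∑ r ∈ S, E.indicator (fun _ => (1 : ENNReal)) (y r) := by
    intro E hE
    rw [Measure.smul_apply, Measure.finsetSum_apply, smul_eq_mul]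
    congr 1
    exact Finset.sum_congr rfl fun r _ => Measure.dirac_apply' _ hE
  refine ⟨⟨(S.card : ENNReal)⁻¹ • ∑ r ∈ S, Measure.dirac (y r), ⟨?_⟩⟩, fun E hE => ?_⟩
  · rw [hval _ MeasurableSet.univ]
    simp only [indicator_univ, Finset.sum_const, nsmul_eq_mul, mul_one]
    exact ENNReal.inv_mul_cancel hpos (ENNReal.natCast_ne_top _)
  · rw [measureReal_def, ProbabilityMeasure.coe_mk, hval E hE, ENNReal.toReal_mul,
      ENNReal.toReal_inv, ENNReal.toReal_natCast, ENNReal.toReal_sum, div_eq_inv_mul]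
    · congr 1
      refine Finset.sum_congr rfl fun r _ => ?_
      by_cases h : y r ∈ E <;> simp [h]
    · intro r _
      by_cases h : y r ∈ E <;> simp [h]

section Existence

variable {A : Type*}

/-- The sequence whose coordinates from `-i` on spell the word `u`, with all others equal to `a`. -/
def extendWord (a : A) (u : List A) (i : ℕ) : ℤ → A := fun k => u.getD (k + i).toNat a

lemma shift_extendWord (a : A) (u : List A) (i : ℕ) :
    shift (extendWord a u i) = extendWord a u (i + 1) := by
  ext k
  simp only [shift, extendWord]
  congr 2
  push_cast
  ring

lemma window_extendWord (a : A) {u : List A} {i n : ℕ} (h : i + n ≤ u.length) :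
    window (extendWord a u i) 0 n = (u.drop i).take n := by
  refine List.ext_getElem (by simp; omega) fun t h1 h2 => ?_
  rw [length_window] at h1
  rw [getElem_window, List.getElem_take, List.getElem_drop, extendWord,
    show ((0 : ℤ) + t + i).toNat = i + t by omega, List.getD_eq_getElem _ _ (by omega)]

lemma isClopen_window [TopologicalSpace A] [DiscreteTopology A] (i : ℤ) (n : ℕ)
    (Q : List A → Prop) : IsClopen {x : ℤ → A | Q (window x i n)} := by
  have h : Continuous fun (x : ℤ → A) (t : Fin n) => x (i + (t : ℕ)) :=
    continuous_pi fun t => continuous_apply _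
  exact (isClopen_discrete {v : Fin n → A | Q (List.ofFn v)}).preimage h

variable [Fintype A]

/-- Splitting a free word around a given factor in a given position. -/
lemma card_freeWords_factor_le [DecidableEq A] {β : ℝ} (hβ : 12 < β)
    (hA : 2 ≤ Fintype.card A) {N i n : ℕ}
    (h : i + n ≤ N) (w : List A) :
    (((freeWords A β N).filter fun u => (u.drop i).take n = w).card : ℝ) ≤
      49 ^ 2 / (freeWords A β n).card * (freeWords A β N).card := by
  have hpos : (0 : ℝ) < (freeWords A β n).card := by exact_mod_cast card_freeWords_pos hβ hA n
  have h1 : (((freeWords A β N).filter fun u => (u.drop i).take n = w).card : ℝ) ≤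
      (freeWords A β i).card * (freeWords A β (N - (i + n))).card := by
    rw [← Nat.cast_mul, ← Finset.card_product, Nat.cast_le]
    refine Finset.card_le_card_of_injOn (fun u => (u.take i, u.drop (i + n))) ?_ ?_
    · intro u hu
      simp only [Finset.coe_filter, mem_ofPred_eq, mem_freeWords] at hu
      obtain ⟨⟨hl, hf⟩, -⟩ := hu
      simp only [Finset.coe_product, Set.mem_prod, Finset.mem_coe, mem_freeWords]
      exact ⟨⟨by simp; omega, hf.take _⟩, ⟨by simp; omega,
        hf.of_isInfix (List.drop_suffix _ _).isInfix⟩⟩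
    · intro u hu v hv huv
      simp only [Finset.coe_filter, mem_ofPred_eq] at hu hv
      simp only [Prod.mk.injEq] at huv
      have hdecomp : ∀ u : List A, u = u.take i ++ ((u.drop i).take n ++ u.drop (i + n)) := by
        intro u
        rw [← List.drop_drop, List.take_append_drop, List.take_append_drop]
      rw [hdecomp u, hdecomp v, hu.2, hv.2, huv.1, huv.2]
  have h2 := card_mul_card_freeWords_le (A := A) hβ hA i n
  have h3 := card_mul_card_freeWords_le (A := A) hβ hA (i + n) (N - (i + n))
  rw [Nat.add_sub_cancel' h] at h3
  rw [div_mul_eq_mul_div, le_div_iff₀ hpos]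
  have h4 : (0 : ℝ) ≤ (freeWords A β (N - (i + n))).card := Nat.cast_nonneg _
  calc _ ≤ ((freeWords A β i).card * (freeWords A β (N - (i + n))).card : ℝ) *
        (freeWords A β n).card := by gcongr
    _ = (freeWords A β i).card * (freeWords A β n).card * (freeWords A β (N - (i + n))).card := by
        ring
    _ ≤ 49 * (freeWords A β (i + n)).card * (freeWords A β (N - (i + n))).card := by gcongr
    _ ≤ _ := by linarith

variable [MeasurableSpace A] [MeasurableSingletonClass A]

lemma exists_almost_invariant {β : ℝ} (hβ : 12 < β) (hA : 2 ≤ Fintype.card A) {N : ℕ}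
    (hN : 0 < N) : ∃ ν : ProbabilityMeasure (ℤ → A),
      (∀ E, MeasurableSet E →
        |(ν : Measure (ℤ → A)).real (shift ⁻¹' E) - (ν : Measure (ℤ → A)).real E| ≤ 1 / N) ∧
      ∀ (n : ℕ) (Q : List A → Prop) (S : ℕ → Finset (List A)) (c : ℝ), 0 ≤ c →
        (∀ i, i + n ≤ N → (∀ u ∈ freeWords A β N, Q ((u.drop i).take n) → u ∈ S i) ∧
          ((S i).card : ℝ) ≤ c * (freeWords A β N).card) →
        (ν : Measure (ℤ → A)).real {x | Q (window x 0 n)} ≤ c + n / N := by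
  classical
  obtain ⟨a⟩ : Nonempty A := Fintype.card_pos_iff.1 (by omega)
  set F := freeWords A β N with hF
  have hFpos : (0 : ℝ) < F.card := by exact_mod_cast card_freeWords_pos hβ hA N
  have hNpos : (0 : ℝ) < N := by exact_mod_cast hN
  obtain ⟨ν, hν⟩ := exists_uniform_measure
    (S := Finset.range N ×ˢ F)
    (Finset.Nonempty.product (Finset.nonempty_range_iff.2 hN.ne')
      (Finset.card_pos.1 (card_freeWords_pos hβ hA N)))
    fun r => extendWord a r.2 r.1
  let g : Set (ℤ → A) → ℕ → ℝ := fun E i =>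
    ∑ u ∈ F, E.indicator (fun _ => (1 : ℝ)) (extendWord a u i)
  have hg0 : ∀ E i, 0 ≤ g E i := fun E i =>
    Finset.sum_nonneg fun u _ => indicator_nonneg (fun _ _ => zero_le_one) _
  have hg1 : ∀ E i, g E i ≤ F.card := fun E i => by
    refine (Finset.sum_le_card_nsmul _ _ 1 fun u _ => ?_).trans_eq (by simp)
    exact indicator_le' (fun _ _ => le_rfl) (fun _ _ => zero_le_one) _
  have hνg : ∀ E, MeasurableSet E →
      (ν : Measure (ℤ → A)).real E = (∑ i ∈ Finset.range N, g E i) / (N * F.card) := by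
    intro E hE
    rw [hν E hE, Finset.sum_product, Finset.card_product, Finset.card_range]
    push_cast
    rfl
  refine ⟨ν, fun E hE => ?_, fun n Q S c hc hS => ?_⟩
  · have hshift : ∀ i, g (shift ⁻¹' E) i = g E (i + 1) := fun i =>
      Finset.sum_congr rfl fun u _ => by
        rw [← shift_extendWord]
        rfl
    rw [hνg _ hE, hνg _ (measurable_shift hE), Finset.sum_congr rfl fun i _ => hshift i,
      ← sub_div, ← Finset.sum_sub_distrib, Finset.sum_range_sub, abs_div,
      abs_of_pos (by positivity : (0 : ℝ) < N * F.card), div_le_div_iff₀ (by positivity) hNpos]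
    have : |g E N - g E 0| ≤ F.card :=
      abs_sub_le_iff.2 ⟨by linarith [hg1 E N, hg0 E 0], by linarith [hg1 E 0, hg0 E N]⟩
    nlinarith
  · rw [hνg _ (measurableSet_window _ _ _)]
    have hbound : ∀ i ∈ Finset.range N, g {x | Q (window x 0 n)} i ≤
        c * F.card + if N < i + n then (F.card : ℝ) else 0 := by
      intro i _
      split_ifs with h
      · exact (hg1 _ i).trans (le_add_of_nonneg_left (by positivity))
      · rw [add_zero]
        push Not at h
        obtain ⟨h1, h2⟩ := hS i h
        refine le_trans ?_ h2
        calc g {x | Q (window x 0 n)} i ≤ ∑ u ∈ F, if u ∈ S i then (1 : ℝ) else 0 := by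
              refine Finset.sum_le_sum fun u hu => ?_
              have hul := (mem_freeWords.1 hu).1
              have hw := window_extendWord a (u := u) (i := i) (n := n) (by omega)
              by_cases hQ : extendWord a u i ∈ {x | Q (window x 0 n)}
              · rw [indicator_of_mem hQ, if_pos (h1 u hu (hw ▸ hQ))]
              · rw [indicator_of_notMem hQ]
                split_ifs <;> simp
          _ = ((F.filter (· ∈ S i)).card : ℝ) := by
              rw [Finset.sum_ite, Finset.sum_const_zero, add_zero, Finset.sum_const, nsmul_one]
          _ ≤ (S i).card := by
              exact_mod_cast Finset.card_le_card fun u hu => (Finset.mem_filter.1 hu).2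
    have hcard : ((Finset.range N).filter fun i => N < i + n).card ≤ n := by
      refine (Finset.card_le_card (t := Finset.Ico (N - n) N) fun i hi => ?_).trans ?_
      · rw [Finset.mem_filter, Finset.mem_range] at hi
        rw [Finset.mem_Ico]
        omega
      · rw [Nat.card_Ico]
        omega
    have hsum := Finset.sum_le_sum hbound
    rw [Finset.sum_add_distrib, Finset.sum_const, Finset.card_range, nsmul_eq_mul,
      ← Finset.sum_filter, Finset.sum_const, nsmul_eq_mul] at hsum
    rw [div_le_iff₀ (by positivity)]
    refine hsum.trans ?_
    have h3 : (((Finset.range N).filter fun i => N < i + n).card : ℝ) * F.card ≤ n * F.card :=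
      mul_le_mul_of_nonneg_right (by exact_mod_cast hcard) hFpos.le
    have h4 : (c + n / N) * (N * F.card) = N * (c * F.card) + n * F.card := by field_simp
    linarith

theorem exists_invariant_measure {β : ℝ} (hβ : 12 < β) (hA : 2 ≤ Fintype.card A) :
    ∃ μ : Measure (ℤ → A), IsProbabilityMeasure μ ∧ IsShiftInvariant μ ∧
      (∀ᵐ x ∂μ, ∀ i n, IsFree β (window x i n)) ∧
      ∀ n w, μ.real {x | window x 0 n = w} ≤ 49 ^ 2 / (freeWords A β n).card := by
  classical
  let _ : TopologicalSpace A := ⊥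
  have _ : DiscreteTopology A := ⟨rfl⟩
  choose ν hνinv hνle using fun N : ℕ => exists_almost_invariant (A := A) hβ hA N.succ_pos
  let U : Ultrafilter ℕ := hyperfilter ℕ
  obtain ⟨μ, hμ⟩ : ∃ μ, Tendsto ν U (nhds μ) := ⟨_, (U.map ν).le_nhds_lim⟩
  have hU : (U : Filter ℕ) ≤ atTop := by
    rw [← Nat.cofinite_eq_atTop]
    exact hyperfilter_le_cofinite
  have hinv0 : ∀ c : ℝ, Tendsto (fun N : ℕ => c / (N.succ : ℝ)) U (nhds 0) := fun c =>
    ((tendsto_const_div_atTop_nhds_zero_nat c).comp (tendsto_add_atTop_nat 1)).mono_left hU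
  have hlim : ∀ (i : ℤ) (n : ℕ) (Q : List A → Prop),
      Tendsto (fun N => (ν N : Measure (ℤ → A)).real {x | Q (window x i n)}) U
        (nhds ((μ : Measure (ℤ → A)).real {x | Q (window x i n)})) := fun i n Q =>
    NNReal.tendsto_coe.2
      (ProbabilityMeasure.tendsto_measure_of_isClopen_of_tendsto hμ (isClopen_window i n Q))
  have hshift : IsShiftInvariant (μ : Measure (ℤ → A)) := by
    rw [isShiftInvariant_iff_map]
    have := Measure.isProbabilityMeasure_map (μ := (μ : Measure (ℤ → A)))
      measurable_shift.aemeasurable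
    refine ext_of_generate_finite _ generateFrom_windowSets
      isSetRing_windowSets.isSetSemiring.isPiSystem ?_ (by simp)
    rintro _ ⟨k, Q, rfl⟩
    rw [Measure.map_apply measurable_shift (measurableSet_window _ _ _)]
    have hpre : shift ⁻¹' {x : ℤ → A | Q (window x (-k) (2 * k))} =
        {x | Q (window x (-k + 1) (2 * k))} := by
      ext x
      simp only [mem_preimage, mem_ofPred_eq, window_shift]
    have h1 := (hlim (-k + 1) (2 * k) Q).sub (hlim (-k) (2 * k) Q)
    have h2 : Tendsto (fun N => (ν N : Measure (ℤ → A)).real {x | Q (window x (-k + 1) (2 * k))} -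
        (ν N : Measure (ℤ → A)).real {x | Q (window x (-k) (2 * k))}) U (nhds 0) := by
      refine squeeze_zero_norm (fun N => ?_) (hinv0 1)
      rw [← hpre]
      exact hνinv N _ (measurableSet_window _ _ _)
    rw [hpre]
    exact (measureReal_eq_measureReal_iff).1 (sub_eq_zero.1 (tendsto_nhds_unique h1 h2))
  have hbound : ∀ (n : ℕ) (Q : List A → Prop) (S : ℕ → ℕ → Finset (List A)) (c : ℝ), 0 ≤ c →
      (∀ N i, i + n ≤ N → (∀ u ∈ freeWords A β N, Q ((u.drop i).take n) → u ∈ S N i) ∧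
          ((S N i).card : ℝ) ≤ c * (freeWords A β N).card) →
      (μ : Measure (ℤ → A)).real {x | Q (window x 0 n)} ≤ c := by
    intro n Q S c hc hS
    have h := (hinv0 n).const_add c
    rw [add_zero] at h
    exact le_of_tendsto_of_tendsto' (hlim 0 n Q) h fun N =>
      hνle N n Q (S N.succ) c hc (hS N.succ)
  refine ⟨μ, inferInstance, hshift, ?_, fun n w => ?_⟩
  · rw [ae_all_iff]
    intro i
    rw [ae_all_iff]
    intro n
    rw [ae_iff, hshift.measure_window i n (fun w => ¬ IsFree β w)]
    have h := hbound n (fun w => ¬ IsFree β w) (fun _ _ => ∅) 0 le_rfl fun N i _ =>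
      ⟨fun u hu hQ => absurd ((mem_freeWords.1 hu).2.of_isInfix
        ((List.take_prefix _ _).isInfix.trans (List.drop_suffix _ _).isInfix)) hQ, by simp⟩
    exact (measureReal_eq_zero_iff).1 (le_antisymm h measureReal_nonneg)
  · exact hbound n (· = w) (fun N i => (freeWords A β N).filter fun u => (u.drop i).take n = w) _
      (by positivity) fun N i h =>
        ⟨fun u hu hQ => Finset.mem_filter.2 ⟨hu, hQ⟩, card_freeWords_factor_le hβ hA h w⟩

end Existence

section BetaFree

variable {d : ℕ} {β : ℝ}

lemma measurableSet_betaFree : MeasurableSet (betaFree d β) := by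
  have : betaFree d β = ⋂ (i : ℤ) (n : ℕ), {x | IsFree β (window x i n)} := by
    ext x
    simp only [mem_iInter]
    exact mem_betaFree_iff
  rw [this]
  exact MeasurableSet.iInter fun i => MeasurableSet.iInter fun n => measurableSet_window i n _

lemma measure_betaFree_eq_one_iff {μ : Measure (ℤ → Fin d)} [IsProbabilityMeasure μ] :
    μ (betaFree d β) = 1 ↔ ∀ᵐ x ∂μ, ∀ i n, IsFree β (window x i n) := by
  rw [← prob_compl_eq_zero_iff measurableSet_betaFree]
  simp only [← mem_betaFree_iff]
  rfl

lemma langN_subset (n : ℕ) : langN (betaFree d β) n ⊆ freeWords (Fin d) β n := by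
  rintro w ⟨⟨x, hx, hw⟩, hl⟩
  obtain ⟨i, hi⟩ := factorOf_iff.1 hw
  exact mem_freeWords.2 ⟨hl, hi ▸ mem_betaFree_iff.1 hx i w.length⟩

lemma langN_finite (n : ℕ) : (langN (betaFree d β) n).Finite :=
  (Finset.finite_toSet _).subset (langN_subset n)

lemma window_mem_langN {X : Set (ℤ → Fin d)} {x : ℤ → Fin d} (hx : x ∈ X) (n : ℕ) :
    window x 0 n ∈ langN X n :=
  ⟨⟨x, hx, factorOf_iff.2 ⟨0, by rw [length_window]⟩⟩, length_window _ _ _⟩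

lemma wordEntropy_le_log_ncard_langN {μ : Measure (ℤ → Fin d)} [IsProbabilityMeasure μ]
    (hfree : ∀ᵐ x ∂μ, ∀ i n, IsFree β (window x i n)) (n : ℕ) :
    wordEntropy μ n ≤ log (langN (betaFree d β) n).ncard := by
  rw [Set.ncard_eq_toFinset_card _ (langN_finite n)]
  refine wordEntropy_le_log_card (fun w hw => ?_) ?_
  · rw [Set.Finite.mem_toFinset] at hw
    exact mem_words.2 hw.2
  · filter_upwards [hfree] with x hx
    exact (Set.Finite.mem_toFinset _).2 (window_mem_langN (mem_betaFree_iff.2 hx) n)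

lemma log_ncard_langN_le (hβ : 12 < β) (hd : 2 ≤ d) (n : ℕ) :
    log (langN (betaFree d β) n).ncard ≤ log (freeWords (Fin d) β n).card := by
  have hpos := card_freeWords_pos (A := Fin d) hβ (by simpa using hd) n
  rcases (langN (betaFree d β) n).ncard.eq_zero_or_pos with h0 | h0
  · rw [h0, Nat.cast_zero, log_zero]
    exact log_natCast_nonneg _
  · refine log_le_log (by exact_mod_cast h0) ?_
    rw [Nat.cast_le, ← Set.ncard_coe_finset]
    exact Set.ncard_le_ncard (langN_subset n) (Finset.finite_toSet _)

end BetaFree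

lemma Subadditive.mul_le_of_tendsto {u : ℕ → ℝ} (hu : Subadditive u) {a : ℝ}
    (h : Tendsto (fun n : ℕ => u n / n) atTop (nhds a)) {n : ℕ} (hn : n ≠ 0) : n * a ≤ u n := by
  have hb := h.bddBelow_range
  rw [tendsto_nhds_unique h (hu.tendsto_lim hb), mul_comm, ← le_div_iff₀ (by positivity)]
  exact hu.lim_le_div hb hn

lemma log_card_freeWords_le {A : Type*} [Fintype A] {β : ℝ} (hβ : 12 < β)
    (hA : 2 ≤ Fintype.card A) {h : ℝ}
    (hlim : Tendsto (fun n : ℕ => log (freeWords A β n).card / n) atTop (nhds h)) {n : ℕ}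
    (hn : n ≠ 0) : log (freeWords A β n).card - log 49 ≤ n * h := by
  have hpos : ∀ n, (freeWords A β n).card ≠ (0 : ℝ) := fun n => by
    exact_mod_cast (card_freeWords_pos hβ hA n).ne'
  have hsub : Subadditive fun n => log 49 - log (freeWords A β n).card := by
    intro m n
    have := log_le_log (by have := hpos m; have := hpos n; positivity)
      (card_mul_card_freeWords_le hβ hA m n)
    rw [log_mul (hpos m) (hpos n), log_mul (by norm_num) (hpos _)] at this
    linarith
  have hlim' : Tendsto (fun n : ℕ => (log 49 - log (freeWords A β n).card) / n) atTop
      (nhds (-h)) := by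
    simpa only [sub_div, zero_sub] using (tendsto_const_div_atTop_nhds_zero_nat (log 49)).sub hlim
  have := hsub.mul_le_of_tendsto hlim' hn
  linarith

/-- For every `d ≥ 2` and `β > 12`, the `d`-ary `β`-free shift has a unique
measure of maximal entropy. -/
theorem unique_mme_beta_free (d : ℕ) (hd : 2 ≤ d) (β : ℝ) (hβ : 12 < β) (h : ℝ)
    (hEnt : Tendsto (fun n : ℕ => Real.log ((langN (betaFree d β) n).ncard) / n)
      atTop (nhds h)) :
    ∃! μ : Measure (ℤ → Fin d), IsMME (betaFree d β) h μ := by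
  have hA : 2 ≤ Fintype.card (Fin d) := by simpa using hd
  obtain ⟨μ, hμ, hinv, hfree, hle⟩ := exists_invariant_measure (A := Fin d) hβ hA
  have hupper := wordEntropy_le_log_ncard_langN hfree
  have hlang : ∀ n, log (langN (betaFree d β) n).ncard ≤ log (freeWords (Fin d) β n).card :=
    log_ncard_langN_le hβ hd
  have hpos : ∀ n, (freeWords (Fin d) β n).card ≠ (0 : ℝ) := fun n => by
    exact_mod_cast (card_freeWords_pos hβ hA n).ne'
  have hlower : ∀ n, log (freeWords (Fin d) β n).card - log (49 ^ 2) ≤ wordEntropy μ n := by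
    intro n
    refine le_trans (le_of_eq ?_) (log_sub_le_wordEntropy fun w _ => hle n w)
    rw [log_div (by norm_num) (hpos n)]
    ring
  have hconst := tendsto_const_div_atTop_nhds_zero_nat (log (49 ^ 2))
  have hlimμ : Tendsto (fun n : ℕ => wordEntropy μ n / n) atTop (nhds h) := by
    have hl := hEnt.sub hconst
    rw [sub_zero] at hl
    refine tendsto_of_tendsto_of_tendsto_of_le_of_le hl hEnt (fun n => ?_) fun n => ?_
    · rw [← sub_div]
      exact div_le_div_of_nonneg_right (by linarith [hlower n, hlang n]) n.cast_nonneg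
    · exact div_le_div_of_nonneg_right (hupper n) n.cast_nonneg
  have hlimf : Tendsto (fun n : ℕ => log (freeWords (Fin d) β n).card / n) atTop (nhds h) := by
    have hu := hEnt.add hconst
    rw [add_zero] at hu
    refine tendsto_of_tendsto_of_tendsto_of_le_of_le hEnt hu (fun n => ?_) fun n => ?_
    · exact div_le_div_of_nonneg_right (hlang n) n.cast_nonneg
    · rw [← add_div]
      exact div_le_div_of_nonneg_right (by linarith [hlower n, hupper n]) n.cast_nonneg
  have hspread : ∀ ν, IsMME (betaFree d β) h ν → IsProbabilityMeasure ν ∧ IsSpread β ν := by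
    rintro ν ⟨hν, hX, hνinv, hνlim⟩
    simp only [cylEntropySum_eq] at hνlim
    refine ⟨hν, .of_wordEntropy hβ hA hνinv (measure_betaFree_eq_one_iff.1 hX) (K := log 49)
      fun n => ?_⟩
    rcases eq_or_ne n 0 with rfl | hn
    · rw [card_freeWords_zero, Nat.cast_one, log_one]
      have := log_nonneg (show (1 : ℝ) ≤ 49 by norm_num)
      linarith [wordEntropy_nonneg ν 0]
    · exact (log_card_freeWords_le hβ hA hlimf hn).trans
        (hνinv.subadditive_wordEntropy.mul_le_of_tendsto hνlim hn)
  have hMME : IsMME (betaFree d β) h μ :=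
    ⟨hμ, measure_betaFree_eq_one_iff.2 hfree, hinv, by simpa only [cylEntropySum_eq] using hlimμ⟩
  refine ⟨μ, hMME, fun ν hν => ?_⟩
  obtain ⟨_, hsν⟩ := hspread ν hν
  exact hsν.eq hβ hA (hspread μ hMME).2
end

section
/- Let d ≥ 3 be an integer and β ≥ 12 a real number, and let L be the language of the d-ary β-free shift X^d_β with topological entropy h. Then for every n ≥ 1, e^{nh} ≤ #L_n ≤ (1 + d/(d³ − 2d − 1))² · e^{(n+1)h}. -/
open MeasureTheory Filter Real Set

namespace BetaFreeCount

variable {A : Type*}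

/-- The factor of `w` of length `L` at position `i` repeats with step `ℓ`. -/
def PeriodicOn (w : List A) (i L ℓ : ℕ) : Prop :=
  i + L ≤ w.length ∧ ∀ t, t + ℓ < L → w[i + t]? = w[i + t + ℓ]?

/-- The finite word `w` has no `β`-power as a factor. -/
def BetaFreeWord (β : ℝ) (w : List A) : Prop :=
  ∀ i L ℓ, 1 ≤ ℓ → PeriodicOn w i L ℓ → (L : ℝ) < β * ℓ

/-- No prefix of `w` is a 4-power. -/
def NoPrefixPower (w : List A) : Prop :=
  ∀ ℓ, 1 ≤ ℓ → ¬ PeriodicOn w 0 (4 * ℓ) ℓ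

/-- No suffix of `w` is a 4-power. -/
def NoSuffixPower (w : List A) : Prop :=
  ∀ i ℓ, 1 ≤ ℓ → i + 4 * ℓ = w.length → ¬ PeriodicOn w i (4 * ℓ) ℓ

/-- `β`-free finite words without 4-powers as prefixes or suffixes. -/
def GoodWord (β : ℝ) (w : List A) : Prop :=
  (BetaFreeWord β w ∧ NoPrefixPower w) ∧ NoSuffixPower w

lemma PeriodicOn.mono {w : List A} {i L ℓ j M : ℕ} (h : PeriodicOn w i L ℓ)
    (hij : i ≤ j) (hjM : j + M ≤ i + L) : PeriodicOn w j M ℓ := by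
  refine ⟨hjM.trans h.1, fun t ht => ?_⟩
  have := h.2 (j - i + t) (by omega)
  rwa [show i + (j - i + t) = j + t by omega] at this

lemma PeriodicOn.of_append_left {u v : List A} {i L ℓ : ℕ} (h : PeriodicOn (u ++ v) i L ℓ)
    (hi : i + L ≤ u.length) : PeriodicOn u i L ℓ := by
  refine ⟨hi, fun t ht => ?_⟩
  have := h.2 t ht
  rwa [List.getElem?_append_left (by omega), List.getElem?_append_left (by omega)] at this

lemma PeriodicOn.of_append_right {u v : List A} {i L ℓ : ℕ}
    (h : PeriodicOn (u ++ v) (u.length + i) L ℓ) : PeriodicOn v i L ℓ := by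
  have h1 := h.1
  rw [List.length_append] at h1
  refine ⟨by omega, fun t ht => ?_⟩
  have := h.2 t ht
  rw [List.getElem?_append_right (by omega), List.getElem?_append_right (by omega)] at this
  convert this using 2 <;> omega

lemma PeriodicOn.append_left {u : List A} {i L ℓ : ℕ} (h : PeriodicOn u i L ℓ) (v : List A) :
    PeriodicOn (u ++ v) i L ℓ := by
  have h1 := h.1
  refine ⟨by rw [List.length_append]; omega, fun t ht => ?_⟩
  rw [List.getElem?_append_left (by omega), List.getElem?_append_left (by omega)]
  exact h.2 t ht

lemma PeriodicOn.append_right {v : List A} {i L ℓ : ℕ} (h : PeriodicOn v i L ℓ) (u : List A) :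
    PeriodicOn (u ++ v) (u.length + i) L ℓ := by
  have h1 := h.1
  refine ⟨by rw [List.length_append]; omega, fun t ht => ?_⟩
  rw [List.getElem?_append_right (by omega), List.getElem?_append_right (by omega)]
  convert h.2 t ht using 2 <;> omega

lemma BetaFreeWord.of_append_left {β : ℝ} {u v : List A} (h : BetaFreeWord β (u ++ v)) :
    BetaFreeWord β u :=
  fun i L ℓ hℓ hp => h i L ℓ hℓ (hp.append_left v)

lemma BetaFreeWord.of_append_right {β : ℝ} {u v : List A} (h : BetaFreeWord β (u ++ v)) :
    BetaFreeWord β v :=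
  fun i L ℓ hℓ hp => h (u.length + i) L ℓ hℓ (hp.append_right u)

lemma betaFreeWord_join {β : ℝ} (hβ : 12 ≤ β) {u v : List A} (hu : GoodWord β u)
    (hv : GoodWord β v) (a : A) : BetaFreeWord β (u ++ a :: v) := by
  intro i L ℓ hℓ hp
  by_contra hL
  have hL' : 12 * ℓ ≤ L := by
    have : (12 : ℝ) * ℓ ≤ L := by
      have : (12 : ℝ) * ℓ ≤ β * ℓ := by gcongr
      linarith
    exact_mod_cast this
  have hlen := hp.1
  simp only [List.length_append, List.length_cons] at hlen
  have hsplit : u ++ a :: v = (u ++ [a]) ++ v := by simp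
  by_cases h1 : i + L ≤ u.length
  · exact hL (hu.1.1 i L ℓ hℓ (hp.of_append_left h1))
  by_cases h2 : u.length + 1 ≤ i
  · rw [hsplit] at hp
    obtain ⟨j, rfl⟩ := Nat.exists_eq_add_of_le h2
    exact hL (hv.1.1 j L ℓ hℓ (PeriodicOn.of_append_right (u := u ++ [a]) (by simpa using hp)))
  by_cases h3 : i + 4 * ℓ ≤ u.length
  · refine hu.2 (u.length - 4 * ℓ) ℓ hℓ (by omega) ?_
    exact PeriodicOn.of_append_left (hp.mono (by omega) (by omega)) (by omega)
  · refine hv.1.2 ℓ hℓ ?_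
    have := hp.mono (j := u.length + 1) (M := 4 * ℓ) (by omega) (by omega)
    rw [hsplit] at this
    exact PeriodicOn.of_append_right (u := u ++ [a]) (by simpa using this)

/-- A 4-power prefix of `u a v` that is not a prefix of `u` determines the letter `a`. -/
lemma prefix_power_letter {u v : List A} {a : A} {n ℓ : ℕ} (hu : u.length = n)
    (hv : v.length = n) (hu' : NoPrefixPower u) (hℓ : 1 ≤ ℓ)
    (hp : PeriodicOn (u ++ a :: v) 0 (4 * ℓ) ℓ) :
    2 * ℓ ≤ n ∧ u[n - ℓ]? = some a ∧ PeriodicOn u 0 n ℓ := by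
  have hlen := hp.1
  simp only [List.length_append, List.length_cons] at hlen
  have h1 : n < 4 * ℓ := by
    by_contra h
    exact hu' ℓ hℓ (hp.of_append_left (by omega))
  refine ⟨by omega, ?_, (hp.mono le_rfl (by omega)).of_append_left (by omega)⟩
  have := hp.2 (n - ℓ) (by omega)
  rw [zero_add, List.getElem?_append_left (by omega), show n - ℓ + ℓ = n by omega,
    List.getElem?_append_right (by omega), hu] at this
  simpa using this

/-- A 4-power suffix of `u a v` that is not a suffix of `v` determines the letter `a`. -/
lemma suffix_power_letter {u v : List A} {a : A} {n i ℓ : ℕ} (hu : u.length = n)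
    (hv : v.length = n) (hv' : NoSuffixPower v) (hℓ : 1 ≤ ℓ)
    (hi : i + 4 * ℓ = (u ++ a :: v).length)
    (hp : PeriodicOn (u ++ a :: v) i (4 * ℓ) ℓ) :
    2 * ℓ ≤ n ∧ v[ℓ - 1]? = some a ∧ PeriodicOn v 0 n ℓ := by
  have hsplit : u ++ a :: v = (u ++ [a]) ++ v := by simp
  have hlen := hi
  simp only [List.length_append, List.length_cons] at hlen
  have h1 : i ≤ n := by
    by_contra h
    obtain ⟨j, rfl⟩ := Nat.exists_eq_add_of_le (show n + 1 ≤ i by omega)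
    refine hv' j ℓ hℓ (by omega) ?_
    rw [hsplit] at hp
    exact PeriodicOn.of_append_right (u := u ++ [a]) (by simpa [hu] using hp)
  refine ⟨by omega, ?_, ?_⟩
  · have := hp.2 (n - i) (by omega)
    rw [show i + (n - i) = n by omega, List.getElem?_append_right (by omega),
      List.getElem?_append_right (by omega), hu, Nat.sub_self, List.getElem?_cons_zero,
      show n + ℓ - n = (ℓ - 1) + 1 by omega, List.getElem?_cons_succ] at this
    exact this.symm
  · have := hp.mono (j := n + 1) (M := n) (by omega) (by omega)
    rw [hsplit] at this
    exact PeriodicOn.of_append_right (u := u ++ [a]) (by simpa [hu] using this)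

lemma exists_goodWord_join {d : ℕ} (hd : 3 ≤ d) {β : ℝ} (hβ : 12 ≤ β) {n : ℕ}
    {u v : List (Fin d)} (hu : GoodWord β u) (hv : GoodWord β v)
    (hun : u.length = n) (hvn : v.length = n) : ∃ a, GoodWord β (u ++ a :: v) := by
  have hpre : ∀ a b, ¬ NoPrefixPower (u ++ a :: v) → ¬ NoPrefixPower (u ++ b :: v) → a = b := by
    intro a b ha hb
    simp only [NoPrefixPower, not_forall, not_not] at ha hb
    obtain ⟨k, hk, hka⟩ := ha
    obtain ⟨l, hl, hlb⟩ := hb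
    obtain ⟨k2, hk3, hkp⟩ := prefix_power_letter hun hvn hu.1.2 hk hka
    obtain ⟨l2, hl3, hlp⟩ := prefix_power_letter hun hvn hu.1.2 hl hlb
    have e1 := hkp.2 (n - k - l) (by omega)
    have e2 := hlp.2 (n - k - l) (by omega)
    rw [zero_add] at e1 e2
    rw [show n - k - l + k = n - l by omega] at e1
    rw [show n - k - l + l = n - k by omega] at e2
    exact Option.some.inj (by rw [← hk3, ← hl3, ← e1, ← e2])
  have hsuf : ∀ a b, ¬ NoSuffixPower (u ++ a :: v) → ¬ NoSuffixPower (u ++ b :: v) → a = b := by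
    intro a b ha hb
    simp only [NoSuffixPower, not_forall, not_not] at ha hb
    obtain ⟨i, k, hk, hik, hka⟩ := ha
    obtain ⟨j, l, hl, hjl, hlb⟩ := hb
    obtain ⟨k2, hk3, hkp⟩ := suffix_power_letter hun hvn hv.2 hk hik hka
    obtain ⟨l2, hl3, hlp⟩ := suffix_power_letter hun hvn hv.2 hl hjl hlb
    have e1 := hkp.2 (l - 1) (by omega)
    have e2 := hlp.2 (k - 1) (by omega)
    rw [zero_add] at e1 e2
    rw [show l - 1 + k = k - 1 + l by omega] at e1
    exact Option.some.inj (by rw [← hk3, ← hl3, e1, e2])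
  suffices h : ∃ a, NoPrefixPower (u ++ a :: v) ∧ NoSuffixPower (u ++ a :: v) by
    obtain ⟨a, h1, h2⟩ := h
    exact ⟨a, ⟨betaFreeWord_join hβ hu hv a, h1⟩, h2⟩
  by_contra! hcon
  have h01 : (⟨0, by omega⟩ : Fin d) ≠ ⟨1, by omega⟩ := by simp
  have h02 : (⟨0, by omega⟩ : Fin d) ≠ ⟨2, by omega⟩ := by simp
  have h12 : (⟨1, by omega⟩ : Fin d) ≠ ⟨2, by omega⟩ := by simp
  have hbad : ∀ a, ¬ NoPrefixPower (u ++ a :: v) ∨ ¬ NoSuffixPower (u ++ a :: v) :=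
    fun a => not_and_or.mp fun h => hcon a h.1 h.2
  rcases hbad ⟨0, by omega⟩ with h0 | h0 <;> rcases hbad ⟨1, by omega⟩ with h1 | h1 <;>
    rcases hbad ⟨2, by omega⟩ with h2 | h2 <;>
    first
    | exact h01 (hpre _ _ h0 h1)
    | exact h02 (hpre _ _ h0 h2)
    | exact h12 (hpre _ _ h1 h2)
    | exact h01 (hsuf _ _ h0 h1)
    | exact h02 (hsuf _ _ h0 h2)
    | exact h12 (hsuf _ _ h1 h2)

lemma exists_goodWord_extend {d : ℕ} (hd : 3 ≤ d) {β : ℝ} (hβ : 12 ≤ β)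
    {u : List (Fin d)} (hu : GoodWord β u) :
    ∃ p s : List (Fin d), p ≠ [] ∧ s ≠ [] ∧ GoodWord β (p ++ u ++ s) := by
  obtain ⟨a, ha⟩ := exists_goodWord_join hd hβ hu hu rfl rfl
  obtain ⟨b, hb⟩ := exists_goodWord_join hd hβ ha ha rfl rfl
  exact ⟨u ++ [a], b :: (u ++ a :: u), by simp, by simp, by simpa using hb⟩

/-- If every word with property `Q` extends on both sides to a longer such word, then it occurs
in a bi-infinite sequence all of whose factors are factors of words with property `Q`. -/
lemma exists_biinfinite {Q : List A → Prop}
    (hQ : ∀ u, Q u → ∃ p s : List A, p ≠ [] ∧ s ≠ [] ∧ Q (p ++ u ++ s)) {u : List A} (hu : Q u) :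
    ∃ x : ℤ → A, FactorOf u x ∧
      ∀ (i : ℤ) (n : ℕ), ∃ w, Q w ∧ ∃ j : ℕ, ∀ t < n, w[j + t]? = some (x (i + t)) := by
  choose! p s hp hs hps using hQ
  let W : ℕ → List A × ℕ := fun k =>
    Nat.rec (u, 0) (fun _ y => (p y.1 ++ y.1 ++ s y.1, (p y.1).length + y.2)) k
  have hW : ∀ k, W (k + 1) =
    (p (W k).1 ++ (W k).1 ++ s (W k).1, (p (W k).1).length + (W k).2) := fun k => rfl
  have hQW : ∀ k, Q (W k).1 := by
    intro k
    induction k with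
    | zero => exact hu
    | succ k ih => rw [hW]; exact hps _ ih
  have hstep : ∀ k, ∀ j < (W k).1.length,
      (W (k + 1)).1[(p (W k).1).length + j]? = (W k).1[j]? := by
    intro k j hj
    rw [hW]
    simp only [List.append_assoc]
    rw [List.getElem?_append_right (by omega), List.getElem?_append_left (by omega)]
    congr 1; omega
  have hbig : ∀ k, k ≤ (W k).2 ∧ (W k).2 + k ≤ (W k).1.length := by
    intro k
    induction k with
    | zero => simp [W]
    | succ k ih =>
      have h1 := List.length_pos_iff.mpr (hp _ (hQW k))
      have h2 := List.length_pos_iff.mpr (hs _ (hQW k))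
      rw [hW]
      simp only [List.length_append]
      omega
  have hcons : ∀ k m (i : ℤ), 0 ≤ i + (W k).2 → i + (W k).2 < (W k).1.length →
      0 ≤ i + (W (k + m)).2 ∧ i + (W (k + m)).2 < (W (k + m)).1.length ∧
      (W (k + m)).1[(i + (W (k + m)).2).toNat]? = (W k).1[(i + (W k).2).toNat]? := by
    intro k m i h0 h1
    induction m with
    | zero => exact ⟨h0, h1, rfl⟩
    | succ m ih =>
      obtain ⟨a1, a2, a3⟩ := ih
      have hl : (W (k + (m + 1))).2 = (p (W (k + m)).1).length + (W (k + m)).2 := rfl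
      have hl2 : (W (k + (m + 1))).1.length =
        (p (W (k + m)).1).length + (W (k + m)).1.length + (s (W (k + m)).1).length := by
        rw [← add_assoc, hW]; simp only [List.length_append]
      refine ⟨by omega, by omega, ?_⟩
      rw [← a3, ← hstep (k + m) _ (by omega)]
      congr 1
      omega
  have hin : ∀ (i : ℤ) (k : ℕ), i.natAbs < k →
      0 ≤ i + (W k).2 ∧ i + (W k).2 < (W k).1.length := by
    intro i k hk
    have := hbig k
    omega
  have hidx : ∀ i : ℤ, (i + (W (i.natAbs + 1)).2).toNat < (W (i.natAbs + 1)).1.length := by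
    intro i
    have := hin i (i.natAbs + 1) (Nat.lt_succ_self _)
    omega
  let x : ℤ → A := fun i => (W (i.natAbs + 1)).1[(i + (W (i.natAbs + 1)).2).toNat]'(hidx i)
  have hx : ∀ (i : ℤ) (k : ℕ), 0 ≤ i + (W k).2 → i + (W k).2 < (W k).1.length →
      (W k).1[(i + (W k).2).toNat]? = some (x i) := by
    intro i k h0 h1
    obtain ⟨b0, b1⟩ := hin i (i.natAbs + 1) (Nat.lt_succ_self _)
    have e1 := (hcons k (i.natAbs + 1) i h0 h1).2.2
    have e2 := (hcons (i.natAbs + 1) k i b0 b1).2.2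
    rw [← e1, add_comm k, e2]
    exact List.getElem?_eq_getElem (hidx i)
  refine ⟨x, ⟨0, fun t ht => ?_⟩, fun i n => ?_⟩
  · have := hx t 0 (by simp [W]) (by simpa [W] using ht)
    have hW0 : W 0 = (u, 0) := rfl
    rw [hW0] at this
    simp only [Nat.cast_zero, add_zero, Int.toNat_natCast, List.getElem?_eq_getElem ht] at this
    rw [zero_add]
    exact (Option.some.inj this).symm
  · let k := i.natAbs + n + 1
    have h0 := hbig k
    refine ⟨(W k).1, hQW k, (i + (W k).2).toNat, fun t ht => ?_⟩
    obtain ⟨c0, c1⟩ := hin (i + t) k (by omega)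
    rw [← hx (i + t) k c0 c1]
    congr 1
    omega

lemma GoodWord.mem_language {d : ℕ} (hd : 3 ≤ d) {β : ℝ} (hβ : 12 ≤ β)
    {u : List (Fin d)} (hu : GoodWord β u) : u ∈ language (betaFree d β) := by
  obtain ⟨x, hux, hx⟩ := exists_biinfinite (fun u hu => exists_goodWord_extend hd hβ hu) hu
  refine ⟨x, fun w ⟨i, hi⟩ ℓ ⟨hℓ, hℓw, hper⟩ => ?_, hux⟩
  obtain ⟨W, hW, j, hj⟩ := hx i w.length
  rcases Nat.eq_zero_or_pos w.length with h0 | hpos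
  · omega
  refine hW.1.1 j w.length ℓ hℓ ⟨?_, fun t ht => ?_⟩
  · have := hj (w.length - 1) (by omega)
    have := (List.getElem?_eq_some_iff.mp this).1
    omega
  · rw [hj t (by omega), add_assoc, hj (t + ℓ) ht, hi t (by omega), hi (t + ℓ) ht, hper t ht]

lemma betaFreeWord_of_mem_language {d : ℕ} {β : ℝ} (hβ : 1 < β) {w : List (Fin d)}
    (hw : w ∈ language (betaFree d β)) : BetaFreeWord β w := by
  obtain ⟨x, hx, k, hk⟩ := hw
  intro i L ℓ hℓ hp
  have hlen := hp.1
  have hs : ((w.drop i).take L).length = L := by simp; omega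
  by_cases hL : L < ℓ
  · have h1 : (L : ℝ) < ℓ := by exact_mod_cast hL
    have h2 : (0 : ℝ) < ℓ := by exact_mod_cast hℓ
    nlinarith
  have := hx ((w.drop i).take L) ⟨k + i, fun t ht => ?_⟩ ℓ ⟨hℓ, by omega, fun t ht => ?_⟩
  · rwa [hs] at this
  · rw [hs] at ht
    have := hk (i + t) (by omega)
    simp only [List.getElem_take, List.getElem_drop]
    rw [← this]; push_cast; congr 1; ring
  · rw [hs] at ht
    have := hp.2 t ht
    rw [List.getElem?_eq_getElem (by omega), List.getElem?_eq_getElem (by omega)] at this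
    simp only [List.getElem_take, List.getElem_drop]
    simpa [add_assoc] using this

/-- The words of length `n` with property `P`. -/
def wordsOf (P : List A → Prop) (n : ℕ) : Set (List A) := {w | P w ∧ w.length = n}

lemma finite_wordsOf [Finite A] (P : List A → Prop) (n : ℕ) : (wordsOf P n).Finite :=
  (List.finite_length_eq A n).subset fun _ hw => hw.2

lemma ncard_words (d n : ℕ) : {w : List (Fin d) | w.length = n}.ncard = d ^ n := by
  have : Nat.card {w : List (Fin d) | w.length = n} = Nat.card (List.Vector (Fin d) n) := rfl
  rw [← Nat.card_coe_set_eq, this, Nat.card_eq_fintype_card, card_vector, Fintype.card_fin]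

/-- Words with a 4-power at a fixed position are determined by the period and the rest. -/
lemma ncard_le_of_periodicOn {d n i ℓ : ℕ} {S T : Set (List (Fin d))} (hT : T.Finite)
    (hℓ : 1 ≤ ℓ) (hS : ∀ w ∈ S, w.length = n ∧ PeriodicOn w i (4 * ℓ) ℓ)
    (hST : ∀ w ∈ S, w.take i ++ w.drop (i + 4 * ℓ) ∈ T) :
    S.ncard ≤ d ^ ℓ * T.ncard := by
  rw [← ncard_words d ℓ, ← Set.ncard_prod]
  refine Set.ncard_le_ncard_of_injOn
    (fun w => ((w.drop i).take ℓ, w.take i ++ w.drop (i + 4 * ℓ))) ?_ ?_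
    ((List.finite_length_eq _ _).prod hT)
  · intro w hw
    obtain ⟨h1, h2⟩ := hS w hw
    have := h2.1
    refine ⟨?_, hST w hw⟩
    simp only [Set.mem_ofPred_eq, List.length_take, List.length_drop]
    omega
  · intro w hw w' hw' heq
    obtain ⟨h1, h2⟩ := hS w hw
    obtain ⟨h1', h2'⟩ := hS w' hw'
    have hl := h2.1
    obtain ⟨e1, e2⟩ := Prod.mk.inj heq
    obtain ⟨e2, e3⟩ := List.append_inj e2 (by simp [h1, h1'])
    have hper : ∀ t < 4 * ℓ, w[i + t]? = w'[i + t]? := by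
      intro t
      induction t using Nat.strong_induction_on with
      | _ t ih =>
        intro ht
        by_cases htℓ : t < ℓ
        · have := congrArg (fun l : List (Fin d) => l[t]?) e1
          simpa [List.getElem?_take, htℓ] using this
        · have a1 := h2.2 (t - ℓ) (by omega)
          have a2 := h2'.2 (t - ℓ) (by omega)
          rw [add_assoc, Nat.sub_add_cancel (by omega)] at a1 a2
          rw [← a1, ← a2]
          exact ih _ (by omega) (by omega)
    refine List.ext_getElem? fun t => ?_
    by_cases ht : t < i
    · have := congrArg (fun l : List (Fin d) => l[t]?) e2
      simpa [List.getElem?_take, ht] using this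
    by_cases ht' : t < i + 4 * ℓ
    · have := hper (t - i) (by omega)
      rwa [Nat.add_sub_cancel' (by omega)] at this
    · have := congrArg (fun l : List (Fin d) => l[t - (i + 4 * ℓ)]?) e3
      simp only [List.getElem?_drop] at this
      rwa [Nat.add_sub_cancel' (by omega)] at this

/-- Recursive count of the words with property `P` in terms of those with property `Q`, when the
failure of `Q` lets one remove a 4-power. -/
lemma ncard_wordsOf_le {d : ℕ} {P Q : List (Fin d) → Prop} (pos : ℕ → ℕ → ℕ)
    (hPQ : ∀ w, P w → ¬ Q w →
      ∃ ℓ, 1 ≤ ℓ ∧ PeriodicOn w (pos w.length ℓ) (4 * ℓ) ℓ)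
    (hP : ∀ w ℓ, P w → PeriodicOn w (pos w.length ℓ) (4 * ℓ) ℓ →
      P (w.take (pos w.length ℓ) ++ w.drop (pos w.length ℓ + 4 * ℓ))) (n : ℕ) :
    (wordsOf P n).ncard ≤ (wordsOf (fun w => P w ∧ Q w) n).ncard +
      ∑ ℓ ∈ Finset.Icc 1 (n / 4), d ^ ℓ * (wordsOf P (n - 4 * ℓ)).ncard := by
  let S : ℕ → Set (List (Fin d)) := fun ℓ =>
    {w | w ∈ wordsOf P n ∧ PeriodicOn w (pos n ℓ) (4 * ℓ) ℓ}
  have hSfin : ∀ ℓ, (S ℓ).Finite := fun ℓ => (finite_wordsOf P n).subset fun _ hw => hw.1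
  have hcover : wordsOf P n ⊆ wordsOf (fun w => P w ∧ Q w) n ∪
      ⋃ ℓ ∈ Finset.Icc 1 (n / 4), S ℓ := by
    rintro w ⟨hw, hwn⟩
    by_cases hq : Q w
    · exact Or.inl ⟨⟨hw, hq⟩, hwn⟩
    · obtain ⟨ℓ, hℓ, hper⟩ := hPQ w hw hq
      rw [hwn] at hper
      have := hper.1
      refine Or.inr (Set.mem_biUnion (x := ℓ) ?_ ⟨⟨hw, hwn⟩, hper⟩)
      simp only [Finset.coe_Icc, Set.mem_Icc]
      omega
  refine (Set.ncard_le_ncard hcover ((finite_wordsOf _ n).union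
    ((Finset.finite_toSet _).biUnion fun ℓ _ => hSfin ℓ))).trans
    ((Set.ncard_union_le _ _).trans ?_)
  gcongr
  refine (Finset.set_ncard_biUnion_le _ _).trans (Finset.sum_le_sum fun ℓ hℓ => ?_)
  rw [Finset.mem_Icc] at hℓ
  refine ncard_le_of_periodicOn (finite_wordsOf P _) hℓ.1 (fun w hw => ⟨hw.1.2, hw.2⟩)
    fun w hw => ?_
  obtain ⟨⟨hw, rfl⟩, hper⟩ := hw
  refine ⟨hP w ℓ hw hper, ?_⟩
  have := hper.1
  simp only [List.length_append, List.length_take, List.length_drop]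
  omega

lemma le_of_four_power_recursion {d : ℕ} (hd : 3 ≤ d) {y M : ℝ} (hy : 0 < y)
    (hyd : (d : ℝ) ^ 3 ≤ y ^ 4) (hM : 0 ≤ M) {a b : ℕ → ℕ}
    (hab : ∀ n, a n ≤ b n + ∑ ℓ ∈ Finset.Icc 1 (n / 4), d ^ ℓ * a (n - 4 * ℓ))
    (hb : ∀ n, (b n : ℝ) ≤ M * y ^ n) (n : ℕ) :
    (a n : ℝ) ≤ (1 + (d : ℝ) / ((d : ℝ) ^ 3 - 2 * (d : ℝ) - 1)) * (M * y ^ n) := by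
  have hd' : (3 : ℝ) ≤ d := by exact_mod_cast hd
  set C : ℝ := 1 + (d : ℝ) / ((d : ℝ) ^ 3 - 2 * (d : ℝ) - 1) with hC
  have hden : 0 < (d : ℝ) ^ 3 - 2 * (d : ℝ) - 1 := by nlinarith [sq_nonneg ((d : ℝ) - 3)]
  have hC0 : 0 ≤ C := by positivity
  set q : ℝ := 1 / (d : ℝ) ^ 2 with hq
  have hq0 : 0 ≤ q := by positivity
  have hq1 : q < 1 := by rw [hq, div_lt_one (by positivity)]; nlinarith
  have hCq : 1 + C * (q / (1 - q)) ≤ C := by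
    have h1 : q / (1 - q) = 1 / ((d : ℝ) ^ 2 - 1) := by
      have : (d : ℝ) ^ 2 - 1 ≠ 0 := by nlinarith
      have h2 : 1 - q ≠ 0 := by linarith
      rw [div_eq_div_iff h2 this, hq]; field_simp
    have h3 : 0 < (d : ℝ) ^ 2 - 1 := by nlinarith
    have h4 : ∀ D E : ℝ, 0 < D → 0 < E → d * D = E + d + 1 →
        1 + (1 + d / E) * (1 / D) ≤ 1 + d / E := by
      intro D E hD hE hDE
      have h5 : (1 + d / E) * (1 / D) = (E + d) / (E * D) := by field_simp
      have h6 : d / E = (E + d + 1) / (E * D) := by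
        rw [← hDE]; field_simp
      rw [h5, h6]
      have h7 : (E + d) / (E * D) ≤ (E + d + 1) / (E * D) :=
        div_le_div_of_nonneg_right (by linarith) (by positivity)
      linarith
    rw [h1, hC]
    exact h4 _ _ h3 hden (by ring)
  induction n using Nat.strong_induction_on with
  | _ n ih =>
    have hterm : ∀ ℓ ∈ Finset.Icc 1 (n / 4),
        (d : ℝ) ^ ℓ * a (n - 4 * ℓ) ≤ C * (M * y ^ n) * q ^ ℓ := by
      intro ℓ hℓ
      rw [Finset.mem_Icc] at hℓ
      have h1 := ih (n - 4 * ℓ) (by omega)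
      have h2 : (d : ℝ) ^ ℓ ≤ q ^ ℓ * y ^ (4 * ℓ) := by
        rw [pow_mul, ← mul_pow]
        refine pow_le_pow_left₀ (by positivity) ?_ _
        rw [hq, one_div, inv_mul_eq_div, le_div_iff₀ (by positivity)]
        linarith [show (d : ℝ) * d ^ 2 = d ^ 3 by ring]
      have h3 : y ^ n = y ^ (4 * ℓ) * y ^ (n - 4 * ℓ) := by
        rw [← pow_add, Nat.add_sub_cancel' (by omega)]
      calc (d : ℝ) ^ ℓ * a (n - 4 * ℓ)
          ≤ (q ^ ℓ * y ^ (4 * ℓ)) * (C * (M * y ^ (n - 4 * ℓ))) := by gcongr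
        _ = C * (M * y ^ n) * q ^ ℓ := by rw [h3]; ring
    have hgeom : ∑ ℓ ∈ Finset.Icc 1 (n / 4), q ^ ℓ ≤ q / (1 - q) := by
      rw [← Finset.Ico_succ_right_eq_Icc]
      exact (geom_sum_Ico_le_of_lt_one hq0 hq1).trans_eq (by rw [pow_one])
    have hab' : (a n : ℝ) ≤ b n + ∑ ℓ ∈ Finset.Icc 1 (n / 4), (d : ℝ) ^ ℓ * a (n - 4 * ℓ) := by
      exact_mod_cast hab n
    calc (a n : ℝ) ≤ b n + ∑ ℓ ∈ Finset.Icc 1 (n / 4), (d : ℝ) ^ ℓ * a (n - 4 * ℓ) := hab'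
      _ ≤ M * y ^ n + ∑ ℓ ∈ Finset.Icc 1 (n / 4), C * (M * y ^ n) * q ^ ℓ :=
          add_le_add (hb n) (Finset.sum_le_sum hterm)
      _ ≤ M * y ^ n + C * (M * y ^ n) * (q / (1 - q)) := by
          rw [← Finset.mul_sum]; gcongr
      _ = (1 + C * (q / (1 - q))) * (M * y ^ n) := by ring
      _ ≤ C * (M * y ^ n) := by gcongr

lemma ncard_betaFreeWord_le {d : ℕ} (β : ℝ) (n : ℕ) :
    (wordsOf (BetaFreeWord (A := Fin d) β) n).ncard ≤
      (wordsOf (fun w : List (Fin d) => BetaFreeWord β w ∧ NoPrefixPower w) n).ncard +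
      ∑ ℓ ∈ Finset.Icc 1 (n / 4),
        d ^ ℓ * (wordsOf (BetaFreeWord (A := Fin d) β) (n - 4 * ℓ)).ncard := by
  refine ncard_wordsOf_le (fun _ _ => 0) (fun w _ hq => ?_) (fun w ℓ hw _ => ?_) n
  · simpa [NoPrefixPower] using hq
  · rw [← List.take_append_drop (4 * ℓ) w] at hw
    simpa using hw.of_append_right

lemma ncard_noPrefixPower_le {d : ℕ} (β : ℝ) (n : ℕ) :
    (wordsOf (fun w : List (Fin d) => BetaFreeWord β w ∧ NoPrefixPower w) n).ncard ≤
      (wordsOf (GoodWord (A := Fin d) β) n).ncard +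
      ∑ ℓ ∈ Finset.Icc 1 (n / 4), d ^ ℓ *
        (wordsOf (fun w : List (Fin d) => BetaFreeWord β w ∧ NoPrefixPower w)
          (n - 4 * ℓ)).ncard := by
  refine ncard_wordsOf_le (fun m ℓ => m - 4 * ℓ) (fun w _ hq => ?_) (fun w ℓ hw hper => ?_) n
  · simp only [NoSuffixPower, not_forall, not_not] at hq
    obtain ⟨i, ℓ, hℓ, hi, hper⟩ := hq
    exact ⟨ℓ, hℓ, by rwa [← hi, Nat.add_sub_cancel]⟩
  · have := hper.1
    rw [List.drop_eq_nil_of_le (by omega), List.append_nil]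
    have hsplit := List.take_append_drop (w.length - 4 * ℓ) w
    refine ⟨BetaFreeWord.of_append_left (hsplit ▸ hw.1), fun k hk hk' => hw.2 k hk ?_⟩
    rw [← hsplit]
    exact hk'.append_left _

lemma ncard_goodWord_sq_le {d : ℕ} (hd : 3 ≤ d) {β : ℝ} (hβ : 12 ≤ β) (n : ℕ) :
    (wordsOf (GoodWord (A := Fin d) β) n).ncard ^ 2 ≤
      (wordsOf (GoodWord (A := Fin d) β) (2 * n + 1)).ncard := by
  have hj : ∀ q ∈ wordsOf (GoodWord (A := Fin d) β) n ×ˢ wordsOf (GoodWord (A := Fin d) β) n,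
      ∃ a, GoodWord β (q.1 ++ a :: q.2) :=
    fun q hq => exists_goodWord_join hd hβ hq.1.1 hq.2.1 hq.1.2 hq.2.2
  have : Nonempty (Fin d) := ⟨⟨0, by omega⟩⟩
  choose! f hf using hj
  rw [sq, ← Set.ncard_prod]
  refine Set.ncard_le_ncard_of_injOn (fun q => q.1 ++ f q :: q.2) (fun q hq => ⟨hf q hq, ?_⟩) ?_
    (finite_wordsOf _ _)
  · have h1 := hq.1.2
    have h2 := hq.2.2
    simp only [List.length_append, List.length_cons]
    omega
  · intro q hq q' hq' heq
    obtain ⟨h1, h2⟩ := List.append_inj heq (hq.1.2.trans hq'.1.2.symm)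
    exact Prod.ext h1 (List.cons.inj h2).2

lemma ncard_goodWord_pow_le {d : ℕ} (hd : 3 ≤ d) {β : ℝ} (hβ : 12 ≤ β) (n k : ℕ) :
    (wordsOf (GoodWord (A := Fin d) β) n).ncard ^ 2 ^ k ≤
      (wordsOf (GoodWord (A := Fin d) β) (2 ^ k * (n + 1) - 1)).ncard := by
  induction k with
  | zero => simp
  | succ k ih =>
    have hpos : 0 < 2 ^ k * (n + 1) := by positivity
    have e : 2 ^ (k + 1) * (n + 1) - 1 = 2 * (2 ^ k * (n + 1) - 1) + 1 := by
      rw [pow_succ, mul_right_comm]; omega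
    rw [e, pow_succ, pow_mul]
    exact (Nat.pow_le_pow_left ih 2).trans (ncard_goodWord_sq_le hd hβ _)

lemma finite_langN {d : ℕ} (X : Set (ℤ → Fin d)) (n : ℕ) : (langN X n).Finite :=
  finite_wordsOf _ n

lemma ncard_goodWord_le_langN {d : ℕ} (hd : 3 ≤ d) {β : ℝ} (hβ : 12 ≤ β) (n : ℕ) :
    (wordsOf (GoodWord (A := Fin d) β) n).ncard ≤ (langN (betaFree d β) n).ncard :=
  Set.ncard_le_ncard (fun _ hw => ⟨hw.1.mem_language hd hβ, hw.2⟩) (finite_langN _ n)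

lemma ncard_langN_add_le {d : ℕ} (X : Set (ℤ → Fin d)) (m n : ℕ) :
    (langN X (m + n)).ncard ≤ (langN X m).ncard * (langN X n).ncard := by
  rw [← Set.ncard_prod]
  refine Set.ncard_le_ncard_of_injOn (fun w => (w.take m, w.drop m)) ?_ ?_
    ((finite_langN X m).prod (finite_langN X n))
  · rintro w ⟨⟨x, hx, i, hi⟩, hw⟩
    refine ⟨⟨⟨x, hx, i, fun t ht => ?_⟩, by simp [hw]⟩,
      ⟨⟨x, hx, i + m, fun t ht => ?_⟩, by simp [hw]⟩⟩
    · rw [List.length_take] at ht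
      rw [List.getElem_take]
      exact hi t (by omega)
    · rw [List.length_drop] at ht
      rw [List.getElem_drop, ← hi (m + t) (by omega)]
      push_cast; congr 1; ring
  · intro w _ w' _ heq
    obtain ⟨h1, h2⟩ := Prod.mk.inj heq
    rw [← List.take_append_drop m w, ← List.take_append_drop m w', h1, h2]

lemma ncard_langN_mul_le {d : ℕ} (X : Set (ℤ → Fin d)) (n k : ℕ) :
    (langN X ((k + 1) * n)).ncard ≤ (langN X n).ncard ^ (k + 1) := by
  induction k with
  | zero => simp
  | succ k ih =>
    rw [add_mul _ 1, one_mul, pow_succ]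
    exact (ncard_langN_add_le X _ n).trans (Nat.mul_le_mul_right _ ih)

lemma goodWord_of_length_le_three {β : ℝ} (hβ : 12 ≤ β) {w : List A} (hw : w.length ≤ 3) :
    GoodWord β w := by
  refine ⟨⟨fun i L ℓ hℓ hp => ?_, fun ℓ hℓ hp => ?_⟩, fun i ℓ hℓ hi _ => by omega⟩
  · have hL : (L : ℝ) ≤ 3 := by
      have := hp.1
      exact_mod_cast (show L ≤ 3 by omega)
    have hℓ' : (1 : ℝ) ≤ ℓ := by exact_mod_cast hℓ
    nlinarith
  · have := hp.1
    omega

lemma ncard_langN_pos {d : ℕ} (hd : 3 ≤ d) {β : ℝ} (hβ : 12 ≤ β) (n : ℕ) :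
    0 < (langN (betaFree d β) n).ncard := by
  obtain ⟨x, hx, -⟩ := (goodWord_of_length_le_three (A := Fin d) hβ (w := []) (by simp)).mem_language
    hd hβ
  refine (Set.ncard_pos (finite_langN _ n)).mpr
    ⟨List.ofFn fun t : Fin n => x t, ⟨x, hx, 0, fun t ht => ?_⟩, by simp⟩
  simp

section Entropy

variable {d : ℕ} {β h : ℝ}

lemma exp_le_ncard_langN (hd : 3 ≤ d) (hβ : 12 ≤ β)
    (hEnt : Tendsto (fun n : ℕ => Real.log ((langN (betaFree d β) n).ncard) / n)
      atTop (nhds h)) {n : ℕ} (hn : 1 ≤ n) :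
    Real.exp (n * h) ≤ ((langN (betaFree d β) n).ncard : ℝ) := by
  have hpos := ncard_langN_pos hd hβ
  have hn' : (0 : ℝ) < n := by exact_mod_cast hn
  have hsub : Tendsto (fun k : ℕ => (k + 1) * n) atTop atTop :=
    tendsto_atTop_mono
      (fun k => (Nat.le_succ k).trans (Nat.le_mul_of_pos_right _ hn)) tendsto_id
  have hle : h ≤ Real.log ((langN (betaFree d β) n).ncard) / n := by
    refine le_of_tendsto (hEnt.comp hsub) (Eventually.of_forall fun k => ?_)
    have hk : Real.log ((langN (betaFree d β) ((k + 1) * n)).ncard) ≤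
        (k + 1 : ℕ) * Real.log ((langN (betaFree d β) n).ncard) := by
      rw [← Real.log_pow]
      exact Real.log_le_log (by exact_mod_cast hpos _)
        (by exact_mod_cast ncard_langN_mul_le _ n k)
    simp only [Function.comp_apply]
    rw [div_le_div_iff₀ (by positivity) hn']
    push_cast at hk ⊢
    nlinarith
  rw [le_div_iff₀ hn', mul_comm] at hle
  rw [← Real.exp_log (show (0 : ℝ) < (langN (betaFree d β) n).ncard by exact_mod_cast hpos n)]
  exact Real.exp_le_exp.mpr hle

lemma ncard_goodWord_le_exp (hd : 3 ≤ d) (hβ : 12 ≤ β)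
    (hEnt : Tendsto (fun n : ℕ => Real.log ((langN (betaFree d β) n).ncard) / n)
      atTop (nhds h)) (n : ℕ) :
    ((wordsOf (GoodWord (A := Fin d) β) n).ncard : ℝ) ≤ Real.exp ((n + 1) * h) := by
  rcases Nat.eq_zero_or_pos (wordsOf (GoodWord (A := Fin d) β) n).ncard with h0 | hg
  · rw [h0, Nat.cast_zero]; positivity
  have hg' : (1 : ℝ) ≤ (wordsOf (GoodWord (A := Fin d) β) n).ncard := by exact_mod_cast hg
  have hsub : Tendsto (fun k : ℕ => 2 ^ (k + 1) * (n + 1) - 1) atTop atTop := by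
    refine tendsto_atTop_mono (fun k => ?_) tendsto_id
    have := Nat.lt_two_pow_self (n := k + 1)
    have : 2 ^ (k + 1) ≤ 2 ^ (k + 1) * (n + 1) := Nat.le_mul_of_pos_right _ (by omega)
    simp only [id]
    omega
  have hle : Real.log (wordsOf (GoodWord (A := Fin d) β) n).ncard / (n + 1) ≤ h := by
    refine ge_of_tendsto (hEnt.comp hsub) (Eventually.of_forall fun k => ?_)
    have hk : (2 ^ (k + 1) : ℕ) * Real.log (wordsOf (GoodWord (A := Fin d) β) n).ncard ≤
        Real.log ((langN (betaFree d β) (2 ^ (k + 1) * (n + 1) - 1)).ncard) := by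
      rw [← Real.log_pow]
      exact Real.log_le_log (by positivity) (by
        exact_mod_cast (ncard_goodWord_pow_le hd hβ n (k + 1)).trans
          (ncard_goodWord_le_langN hd hβ _))
    have h2 : 2 ≤ 2 ^ (k + 1) * (n + 1) := by
      have : 2 ^ 1 ≤ 2 ^ (k + 1) := Nat.pow_le_pow_right (by omega) (by omega)
      nlinarith
    have hlog := Real.log_nonneg hg'
    have h2' : (2 : ℝ) ≤ 2 ^ (k + 1) * (n + 1) := by exact_mod_cast h2
    simp only [Function.comp_apply]
    rw [Nat.cast_sub (by omega), div_le_div_iff₀ (by positivity) (by push_cast; linarith)]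
    push_cast at hk ⊢
    nlinarith
  rw [div_le_iff₀ (by positivity), mul_comm] at hle
  rw [← Real.exp_log (show (0 : ℝ) < _ from zero_lt_one.trans_le hg')]
  exact Real.exp_le_exp.mpr hle

lemma cube_le_exp_pow (hd : 3 ≤ d) (hβ : 12 ≤ β)
    (hEnt : Tendsto (fun n : ℕ => Real.log ((langN (betaFree d β) n).ncard) / n)
      atTop (nhds h)) : (d : ℝ) ^ 3 ≤ Real.exp h ^ 4 := by
  have heq : wordsOf (GoodWord (A := Fin d) β) 3 = {w | w.length = 3} :=
    Set.ext fun w => ⟨fun hw => hw.2, fun hw => ⟨goodWord_of_length_le_three hβ hw.le, hw⟩⟩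
  have := ncard_goodWord_le_exp hd hβ hEnt 3
  rw [heq, ncard_words] at this
  rw [← Real.exp_nat_mul]
  push_cast at this ⊢
  norm_num at this ⊢
  exact this

end Entropy

end BetaFreeCount

/-- Counting bounds for the `d`-ary `β`-free shift, `d ≥ 3`, `β ≥ 12`. -/
theorem card_bounds_beta_free_ge_three (d : ℕ) (hd : 3 ≤ d) (β : ℝ) (hβ : 12 ≤ β) (h : ℝ)
    (hEnt : Tendsto (fun n : ℕ => Real.log ((langN (betaFree d β) n).ncard) / n)
      atTop (nhds h)) :
    ∀ n : ℕ, 1 ≤ n →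
      Real.exp (n * h) ≤ ((langN (betaFree d β) n).ncard : ℝ) ∧
      ((langN (betaFree d β) n).ncard : ℝ) ≤
        (1 + (d : ℝ) / ((d : ℝ) ^ 3 - 2 * (d : ℝ) - 1)) ^ 2 * Real.exp ((n + 1) * h) := by
  intro n hn
  refine ⟨BetaFreeCount.exp_le_ncard_langN hd hβ hEnt hn, ?_⟩
  have hy := Real.exp_pos h
  have hyd := BetaFreeCount.cube_le_exp_pow hd hβ hEnt
  have hd' : (3 : ℝ) ≤ d := by exact_mod_cast hd
  have hC : 0 ≤ 1 + (d : ℝ) / ((d : ℝ) ^ 3 - 2 * (d : ℝ) - 1) := by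
    have : 0 < (d : ℝ) ^ 3 - 2 * (d : ℝ) - 1 := by nlinarith [sq_nonneg ((d : ℝ) - 3)]
    positivity
  have hexp : ∀ m : ℕ, Real.exp ((m + 1) * h) = Real.exp h * Real.exp h ^ m := fun m => by
    rw [← Real.exp_nat_mul, ← Real.exp_add]; ring_nf
  have hG := fun m => (BetaFreeCount.ncard_goodWord_le_exp hd hβ hEnt m).trans_eq (hexp m)
  have hB := BetaFreeCount.le_of_four_power_recursion hd hy hyd hy.le
    (BetaFreeCount.ncard_noPrefixPower_le β) hG
  simp only [← mul_assoc] at hB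
  have hW := BetaFreeCount.le_of_four_power_recursion hd hy hyd (by positivity)
    (BetaFreeCount.ncard_betaFreeWord_le β) hB n
  have hL : (langN (betaFree d β) n).ncard ≤
      (BetaFreeCount.wordsOf (BetaFreeCount.BetaFreeWord (A := Fin d) β) n).ncard :=
    Set.ncard_le_ncard
      (fun w hw => ⟨BetaFreeCount.betaFreeWord_of_mem_language (by linarith) hw.1, hw.2⟩)
      (BetaFreeCount.finite_wordsOf _ n)
  rw [hexp, sq, mul_assoc]
  calc ((langN (betaFree d β) n).ncard : ℝ) ≤ _ := by exact_mod_cast hL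
    _ ≤ _ := hW
    _ = _ := by ring
end

section
/- Suppose d ≥ 3 and β ≥ 12, or d = 2 and β > 12 (β real). Then every word w in the language L of X^d_β admits a decomposition w = u^p v u^s, where v ∈ G and where u^p and u^s each belong to C, i.e., each is a (possibly empty) concatenation of 4-powers of words of L. -/
open MeasureTheory Filter Real Set

/-- The language of a set of bi-infinite sequences is closed under factors. -/
theorem mem_language_of_infix {A : Type*} {X : Set (ℤ → A)} {u w : List A}
    (hw : w ∈ language X) (h : u <:+: w) : u ∈ language X := by
  obtain ⟨x, hx, i, hi⟩ := hw
  obtain ⟨a, b, rfl⟩ := h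
  refine ⟨x, hx, i + a.length, fun t ht => ?_⟩
  have := hi (a.length + t) (by simp; omega)
  rw [List.getElem_append_left (by simp; omega), List.getElem_append_right (by omega)] at this
  simpa [add_assoc] using this

/-- Every word of the language splits as a concatenation of 4-powers followed by a word
without 4-power prefixes. -/
theorem exists_flatten_append {A : Type*} {X : Set (ℤ → A)} (w : List A) (hw : w ∈ language X) :
    ∃ (ps : List (List A)) (v : List A),
      (∀ p ∈ ps, ∃ v ∈ language X, v ≠ [] ∧ p = v ++ v ++ v ++ v) ∧ w = ps.flatten ++ v ∧
      ∀ p : List A, p <+: v → ¬ IsFourPower p := by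
  by_cases h : ∀ p : List A, p <+: w → ¬ IsFourPower p
  · exact ⟨[], w, by simp, by simp, h⟩
  · push Not at h
    obtain ⟨_, ⟨r, rfl⟩, s, hs, rfl⟩ := h
    have hpos := List.length_pos_iff.2 hs
    obtain ⟨ps, v, hps, hr, hv⟩ := exists_flatten_append r
      (mem_language_of_infix hw (List.suffix_append _ _).isInfix)
    refine ⟨(s ++ s ++ s ++ s) :: ps, v, ?_, by simp [hr], hv⟩
    rintro p (_ | ⟨_, hp⟩)
    · exact ⟨s, mem_language_of_infix hw ⟨[], s ++ s ++ s ++ r, by simp⟩, hs, rfl⟩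
    · exact hps p hp
termination_by w.length
decreasing_by subst_vars; simp; omega

/-- Every word of the language splits as a word without 4-power suffixes followed by a
concatenation of 4-powers. -/
theorem exists_append_flatten {A : Type*} {X : Set (ℤ → A)} (w : List A) (hw : w ∈ language X) :
    ∃ (ps : List (List A)) (v : List A),
      (∀ p ∈ ps, ∃ v ∈ language X, v ≠ [] ∧ p = v ++ v ++ v ++ v) ∧ w = v ++ ps.flatten ∧
      ∀ s : List A, s <:+ v → ¬ IsFourPower s := by
  by_cases h : ∀ s : List A, s <:+ w → ¬ IsFourPower s
  · exact ⟨[], w, by simp, by simp, h⟩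
  · push Not at h
    obtain ⟨_, ⟨r, rfl⟩, s, hs, rfl⟩ := h
    have hpos := List.length_pos_iff.2 hs
    obtain ⟨ps, v, hps, hr, hv⟩ := exists_append_flatten r
      (mem_language_of_infix hw (List.prefix_append _ _).isInfix)
    refine ⟨ps ++ [s ++ s ++ s ++ s], v, ?_, by simp [hr], hv⟩
    intro p hp
    rcases List.mem_append.1 hp with hp | hp
    · exact hps p hp
    · exact ⟨s, mem_language_of_infix hw ⟨r ++ s ++ s ++ s, [], by simp⟩, hs, by simpa using hp⟩
termination_by w.length
decreasing_by subst_vars; simp; omega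

/-- Decomposition: every word of the language of `X^d_β` is a concatenation
`u^p v u^s` with `v` a good word and `u^p, u^s` concatenations of 4-powers. -/
theorem decomposition_beta_free (d : ℕ) (β : ℝ)
    (hcase : (3 ≤ d ∧ 12 ≤ β) ∨ (d = 2 ∧ 12 < β)) :
    ∀ w ∈ language (betaFree d β), ∃ up v us : List (Fin d),
      up ∈ fourPowerConcat (betaFree d β) ∧ v ∈ goodWords (betaFree d β) ∧
      us ∈ fourPowerConcat (betaFree d β) ∧ w = up ++ v ++ us := by
  intro w hw
  obtain ⟨ps, r, hps, rfl, hr⟩ := exists_flatten_append w hw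
  have hr_mem := mem_language_of_infix hw (List.suffix_append _ _).isInfix
  obtain ⟨qs, v, hqs, rfl, hv⟩ := exists_append_flatten r hr_mem
  exact ⟨ps.flatten, v, qs.flatten,
    ⟨mem_language_of_infix hw (List.prefix_append _ _).isInfix, ps, hps, rfl⟩,
    ⟨mem_language_of_infix hr_mem (List.prefix_append _ _).isInfix,
      fun p hp => hr p (hp.trans (List.prefix_append _ _)), hv⟩,
    ⟨mem_language_of_infix hr_mem (List.suffix_append _ _).isInfix, qs, hqs, rfl⟩,
    (List.append_assoc _ _ _).symm⟩
end
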